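/- arXiv:1706.03109 — 3 statements merged into one kernel-verified Lean document; each statement's English description precedes it below -/
import Mathlib

section
/- For every integer t ≥ 1 and n = 6t² + 3t + 1, there exists a planar graph G of order n with ψ(G) = ψ_s(G) = ⌊√(6n − 47/4) + 1/2⌋ = 6t + 1. -/
open SimpleGraph

/-- A graph is planar if it has a drawing in the plane: vertices map injectively to points,
edges map to arcs between their endpoints, arc interiors avoid vertex images, and the
interiors of arcs of distinct edges are disjoint. -/
def SimpleGraph.IsPlanar {V : Type*} (G : SimpleGraph V) : Prop :=
  ∃ f : V → ℝ × ℝ, Function.Injective f ∧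
    ∃ γ : ∀ ⦃u v : V⦄, G.Adj u v → _root_.Path (f u) (f v),
      (∀ ⦃u v : V⦄ (h : G.Adj u v), Function.Injective (γ h)) ∧
      (∀ ⦃u v : V⦄ (h : G.Adj u v) (t : unitInterval), t ≠ 0 → t ≠ 1 → ∀ w, γ h t ≠ f w) ∧
      (∀ ⦃u v u' v' : V⦄ (h : G.Adj u v) (h' : G.Adj u' v'), s(u, v) ≠ s(u', v') →
        ∀ s t : unitInterval, s ≠ 0 → s ≠ 1 → γ h s ≠ γ h' t)

/-- The cone over `G`: a new vertex `none` joined to every vertex of `G`. -/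
def SimpleGraph.cone {V : Type*} (G : SimpleGraph V) : SimpleGraph (Option V) :=
  SimpleGraph.fromRel
    (fun x y => (∃ u v, x = some u ∧ y = some v ∧ G.Adj u v) ∨ x = none)

/-- A graph is outerplanar iff the cone over it is planar. -/
def SimpleGraph.IsOuterplanar {V : Type*} (G : SimpleGraph V) : Prop :=
  G.cone.IsPlanar

/-- A complete `k`-coloring: surjective, and every pair of distinct colors appears on an edge. -/
def SimpleGraph.IsCompleteColoring {V : Type*} {k : ℕ} (G : SimpleGraph V)
    (c : V → Fin k) : Prop :=
  Function.Surjective c ∧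
    ∀ i j : Fin k, i ≠ j → ∃ u v, G.Adj u v ∧ c u = i ∧ c v = j

/-- A proper coloring: adjacent vertices receive distinct colors. -/
def SimpleGraph.IsProperColoring {V : Type*} {k : ℕ} (G : SimpleGraph V)
    (c : V → Fin k) : Prop :=
  ∀ ⦃u v : V⦄, G.Adj u v → c u ≠ c v

/-- The pseudoachromatic number: the largest `k` admitting a complete `k`-coloring. -/
noncomputable def SimpleGraph.pseudoachromatic {V : Type*} (G : SimpleGraph V) : ℕ :=
  sSup {k | ∃ c : V → Fin k, G.IsCompleteColoring c}

/-- The achromatic number: the largest `k` admitting a proper complete `k`-coloring. -/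
noncomputable def SimpleGraph.achromatic {V : Type*} (G : SimpleGraph V) : ℕ :=
  sSup {k | ∃ c : V → Fin k, G.IsProperColoring c ∧ G.IsCompleteColoring c}

/-- The chromatic number: the least `k` admitting a proper `k`-coloring. -/
noncomputable def SimpleGraph.chromNum {V : Type*} (G : SimpleGraph V) : ℕ :=
  sInf {k | ∃ c : V → Fin k, G.IsProperColoring c}

/-- The thickness: the least number of planar subgraphs whose union is `G`. -/
noncomputable def SimpleGraph.thickness {V : Type*} (G : SimpleGraph V) : ℕ :=
  sInf {k | ∃ f : Fin k → SimpleGraph V, (∀ i, (f i).IsPlanar) ∧ (⨆ i, f i) = G}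

/-- The outerthickness: the least number of outerplanar subgraphs whose union is `G`. -/
noncomputable def SimpleGraph.outerthickness {V : Type*} (G : SimpleGraph V) : ℕ :=
  sInf {k | ∃ f : Fin k → SimpleGraph V, (∀ i, (f i).IsOuterplanar) ∧ (⨆ i, f i) = G}

/-- The 4-girth-thickness: the least number of planar subgraphs of girth at least 4
whose union is `G`. -/
noncomputable def SimpleGraph.girth4Thickness {V : Type*} (G : SimpleGraph V) : ℕ :=
  sInf {k | ∃ f : Fin k → SimpleGraph V,
    (∀ i, (f i).IsPlanar ∧ 4 ≤ (f i).egirth) ∧ (⨆ i, f i) = G}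

/-- A nonnegative weight supported on a single member of `Δ`. -/
def Admissible {W : Type*} (Δ : Set (Finset W)) (w : W →₀ ℝ) : Prop :=
  0 ≤ w ∧ ∃ τ ∈ Δ, ∀ i ∉ τ, w i = 0

/-- `Δ` is the facet set of a simplicial complex that can be drawn rectilinearly in the plane.
Points carry homogeneous coordinates, so that convex combinations become linear ones. -/
def Realizable {W : Type*} (Δ : Set (Finset W)) : Prop :=
  ∃ f : W → (ℝ × ℝ) × ℝ, (∀ i, (f i).2 = 1) ∧ ∀ w w', Admissible Δ w → Admissible Δ w' →
    Finsupp.linearCombination ℝ f w = Finsupp.linearCombination ℝ f w' → w = w'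

theorem Realizable.mono {W : Type*} {Δ Δ' : Set (Finset W)} (h : Realizable Δ) (hs : Δ' ⊆ Δ) :
    Realizable Δ' := by
  obtain ⟨f, hf, hinj⟩ := h
  exact ⟨f, hf, fun w w' ⟨hw, τ, hτ, h0⟩ ⟨hw', τ', hτ', h1⟩ =>
    hinj w w' ⟨hw, τ, hs hτ, h0⟩ ⟨hw', τ', hs hτ', h1⟩⟩

/-- The triangle `σ` of a realizable complex may be replaced by the triangles in `F`, which have
their vertices in `σ` and in the set `N` of new vertices. -/
structure Fills {W : Type*} (σ : Finset W) (N : Set W) (F : Set (Finset W)) : Prop where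
  card_left : σ.card = 3
  card : ∀ τ ∈ F, τ.card = 3
  sub : ∀ τ ∈ F, ∀ i ∈ τ, i ∈ σ ∨ i ∈ N
  realizable : ∀ Δ : Set (Finset W), (∀ τ ∈ Δ, τ.card = 3) → σ ∉ Δ →
    (∀ τ ∈ Δ, ∀ i ∈ τ, i ∉ N) → Realizable (insert σ Δ) → Realizable (Δ ∪ F)

namespace Fills

variable {W : Type*} {σ : Finset W} {N N' : Set W} {F F' : Set (Finset W)}

theorem mono (h : Fills σ N F) (hN : N ⊆ N') (hF : F' ⊆ F) : Fills σ N' F' where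
  card_left := h.card_left
  card τ hτ := h.card τ (hF hτ)
  sub τ hτ i hi := (h.sub τ (hF hτ) i hi).imp id (@hN i)
  realizable Δ hc hσ hn hR :=
    (h.realizable Δ hc hσ (fun τ hτ i hi hiN => hn τ hτ i hi (hN hiN)) hR).mono
      (Set.union_subset_union_right _ hF)

/-- Triangles produced by a replacement may be replaced in turn. -/
theorem bind {I : Type*} [Finite I] {τ : I → Finset W} {M : I → Set W} {G : I → Set (Finset W)}
    (h : Fills σ N (F ∪ Set.range τ)) (hτ : Function.Injective τ) (hF : ∀ i, τ i ∉ F)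
    (hG : ∀ i, Fills (τ i) (M i) (G i)) (hM : ∀ i j, i ≠ j → ∀ a ∈ M i, a ∉ M j)
    (hM₀ : ∀ i, ∀ a ∈ M i, a ∉ σ ∧ a ∉ N) :
    Fills σ (N ∪ ⋃ i, M i) (F ∪ ⋃ i, G i) := by
  classical
  have hτsub : ∀ i, ∀ a ∈ τ i, a ∈ σ ∨ a ∈ N := fun i => h.sub _ (Or.inr ⟨i, rfl⟩)
  refine ⟨h.card_left, ?_, ?_, ?_⟩
  · rintro ρ (hρ | hρ)
    · exact h.card ρ (Or.inl hρ)
    · obtain ⟨i, hi⟩ := Set.mem_iUnion.1 hρ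
      exact (hG i).card ρ hi
  · rintro ρ (hρ | hρ) a ha
    · exact (h.sub ρ (Or.inl hρ) a ha).imp id Or.inl
    · obtain ⟨i, hi⟩ := Set.mem_iUnion.1 hρ
      rcases (hG i).sub ρ hi a ha with h' | h'
      · exact (hτsub i a h').imp id Or.inl
      · exact Or.inr (Or.inr (Set.mem_iUnion.2 ⟨i, h'⟩))
  · intro Δ hc hσ hn hR
    have hnN : ∀ ρ ∈ Δ, ∀ a ∈ ρ, a ∉ N := fun ρ hρ a ha haN => hn ρ hρ a ha (Or.inl haN)
    have hnM : ∀ i, ∀ ρ ∈ Δ, ∀ a ∈ ρ, a ∉ M i := fun i ρ hρ a ha haM =>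
      hn ρ hρ a ha (Or.inr (Set.mem_iUnion.2 ⟨i, haM⟩))
    have key : ∀ J : Finset I,
        Realizable (Δ ∪ (F ∪ (⋃ i ∈ J, G i) ∪ τ '' {i | i ∉ J})) := by
      intro J
      induction J using Finset.induction_on with
      | empty =>
        refine (h.realizable Δ hc hσ hnN hR).mono ?_
        simp
      | insert i J hi ih =>
        have := (hG i).realizable (Δ ∪ (F ∪ (⋃ i ∈ J, G i) ∪ τ '' {j | j ∉ insert i J})) ?_ ?_ ?_ ?_
        · refine this.mono ?_
          intro ρ hρ
          simp only [Set.mem_union, Set.mem_iUnion, Finset.mem_insert, exists_prop] at hρ ⊢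
          rcases hρ with hρ | (hρ | ⟨j, rfl | hj, hρ⟩) | hρ
          · tauto
          · tauto
          · tauto
          · exact Or.inl (Or.inr (Or.inl (Or.inr ⟨j, hj, hρ⟩)))
          · tauto
        · rintro ρ (hρ | (hρ | hρ) | ⟨j, -, rfl⟩)
          · exact hc ρ hρ
          · exact h.card ρ (Or.inl hρ)
          · simp only [Set.mem_iUnion] at hρ
            obtain ⟨j, -, hρ⟩ := hρ
            exact (hG j).card ρ hρ
          · exact (hG j).card_left
        · rintro (hρ | (hρ | hρ) | ⟨j, hj, hρ⟩)
          · have : τ i ⊆ σ := fun a ha => (hτsub i a ha).resolve_right (hnN _ hρ a ha)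
            have := Finset.eq_of_subset_of_card_le this (by rw [h.card_left, (hG i).card_left])
            exact hσ (this ▸ hρ)
          · exact hF i hρ
          · simp only [Set.mem_iUnion] at hρ
            obtain ⟨j, hj, hρ⟩ := hρ
            have : τ i ⊆ τ j := fun a ha => ((hG j).sub _ hρ a ha).resolve_right fun hM' =>
              (hτsub i a ha).elim (hM₀ j a hM').1 (hM₀ j a hM').2
            have := Finset.eq_of_subset_of_card_le this
              (by rw [(hG j).card_left, (hG i).card_left])
            exact hi (hτ this ▸ hj)
          · exact hj (by simp [hτ hρ])
        · have hold : ∀ ρ ∈ F ∪ Set.range τ, ∀ a ∈ ρ, a ∉ M i := fun ρ hρ a ha haM =>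
            (h.sub ρ hρ a ha).elim (hM₀ i a haM).1 (hM₀ i a haM).2
          rintro ρ (hρ | (hρ | hρ) | ⟨j, -, rfl⟩) a ha
          · exact hnM i ρ hρ a ha
          · exact hold ρ (Or.inl hρ) a ha
          · simp only [Set.mem_iUnion] at hρ
            obtain ⟨j, hj, hρ⟩ := hρ
            rcases (hG j).sub ρ hρ a ha with h' | h'
            · exact hold (τ j) (Or.inr ⟨j, rfl⟩) a h'
            · exact hM j i (fun e => hi (e ▸ hj)) a h'
          · exact hold (τ j) (Or.inr ⟨j, rfl⟩) a ha
        · refine ih.mono ?_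
          rintro ρ (rfl | hρ | (hρ | hρ) | ⟨j, hj, rfl⟩)
          · exact Or.inr (Or.inr ⟨i, hi, rfl⟩)
          · exact Or.inl hρ
          · exact Or.inr (Or.inl (Or.inl hρ))
          · exact Or.inr (Or.inl (Or.inr hρ))
          · exact Or.inr (Or.inr ⟨j, fun h' => hj (Finset.mem_insert_of_mem h'), rfl⟩)
    cases nonempty_fintype I
    refine (key Finset.univ).mono ?_
    simp

theorem andThen {τ : Finset W} {M : Set W} {G : Set (Finset W)}
    (h : Fills σ N (insert τ F)) (hF : τ ∉ F) (hG : Fills τ M G)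
    (hM₀ : ∀ a ∈ M, a ∉ σ ∧ a ∉ N) : Fills σ (N ∪ M) (F ∪ G) := by
  have := bind (I := Unit) (τ := fun _ => τ) (M := fun _ => M) (G := fun _ => G) (F := F)
    (h.mono subset_rfl (by rintro ρ (hρ | ⟨_, rfl⟩) <;> simp [*]))
    (fun _ _ _ => rfl) (fun _ => hF) (fun _ => hG) (by simp) (fun _ => hM₀)
  simpa [Set.iUnion_const] using this

theorem of_push (L : (W →₀ ℝ) →ₗ[ℝ] (W →₀ ℝ)) (hσ : σ.card = 3) (hc : ∀ τ ∈ F, τ.card = 3)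
    (hsub : ∀ τ ∈ F, ∀ i ∈ τ, i ∈ σ ∨ i ∈ N)
    (htotal : ∀ i, Finsupp.linearCombination ℝ (fun _ => (1 : ℝ)) (L (Finsupp.single i 1)) = 1)
    (hold : ∀ w, (∀ i ∈ N, w i = 0) → L w = w)
    (hnew : ∀ w, 0 ≤ w → ∀ τ ∈ F, (∀ i ∉ τ, w i = 0) → 0 ≤ L w ∧ ∀ i ∉ σ, L w i = 0)
    (hinj : ∀ w w', 0 ≤ w → 0 ≤ w' →
      ((∃ τ ∈ F, ∀ i ∉ τ, w i = 0) ∨ (∀ i ∈ N, w i = 0) ∧ ∃ i ∈ σ, w i = 0) →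
      ((∃ τ ∈ F, ∀ i ∉ τ, w' i = 0) ∨ (∀ i ∈ N, w' i = 0) ∧ ∃ i ∈ σ, w' i = 0) →
      L w = L w' → w = w') : Fills σ N F where
  card_left := hσ
  card := hc
  sub := hsub
  realizable := by
    intro Δ hΔc hΔσ hΔN ⟨f, hf, hR⟩
    have hcomb : ∀ w, Finsupp.linearCombination ℝ
        (fun i => Finsupp.linearCombination ℝ f (L (Finsupp.single i 1))) w =
        Finsupp.linearCombination ℝ f (L w) := by
      intro w
      induction w using Finsupp.induction_linear with
      | zero => simp
      | add a b ha hb => simp [ha, hb]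
      | single i a =>
        rw [Finsupp.linearCombination_single, ← map_smul, ← map_smul, Finsupp.smul_single,
          smul_eq_mul, mul_one]
    have hsnd : ∀ w : W →₀ ℝ, (Finsupp.linearCombination ℝ f w).2 =
        Finsupp.linearCombination ℝ (fun _ => (1 : ℝ)) w := by
      intro w
      induction w using Finsupp.induction_linear with
      | zero => simp
      | add a b ha hb => simp [ha, hb]
      | single i a => simp [hf]
    have hcase : ∀ w, Admissible (Δ ∪ F) w → Admissible (insert σ Δ) (L w) ∧
        ((∃ τ ∈ F, ∀ i ∉ τ, w i = 0) ∨ (∀ i ∈ N, w i = 0) ∧ ∃ i ∈ σ, w i = 0) := by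
      rintro w ⟨hw, τ, hτ | hτ, h0⟩
      · have hN : ∀ i ∈ N, w i = 0 := fun i hi => h0 i fun hiτ => hΔN τ hτ i hiτ hi
        refine ⟨⟨(hold w hN).symm ▸ hw, τ, Or.inr hτ, (hold w hN).symm ▸ h0⟩, Or.inr ⟨hN, ?_⟩⟩
        by_contra! hcon
        have : σ ⊆ τ := fun i hi => by
          by_contra hi'
          exact hcon i hi (h0 i hi')
        have := Finset.eq_of_subset_of_card_le this (by rw [hσ, hΔc τ hτ])
        exact hΔσ (this ▸ hτ)
      · exact ⟨⟨(hnew w hw τ hτ h0).1, σ, Or.inl rfl, (hnew w hw τ hτ h0).2⟩, Or.inl ⟨τ, hτ, h0⟩⟩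
    refine ⟨fun i => Finsupp.linearCombination ℝ f (L (Finsupp.single i 1)),
      fun i => by rw [hsnd, htotal], fun w w' hw hw' he => ?_⟩
    rw [hcomb, hcomb] at he
    exact hinj w w' hw.1 hw'.1 (hcase w hw).2 (hcase w' hw').2
      (hR _ _ (hcase w hw).1 (hcase w' hw').1 he)

end Fills

namespace Fills

variable {W : Type*}

/-- Placing a new vertex inside a triangle. -/
theorem star [DecidableEq W] {x y z p : W} (hxy : x ≠ y) (hxz : x ≠ z) (hyz : y ≠ z)
    (hpx : p ≠ x) (hpy : p ≠ y) (hpz : p ≠ z) :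
    Fills {x, y, z} {p} {{x, y, p}, {x, z, p}, {y, z, p}} := by
  set D : W →₀ ℝ := Finsupp.single x (1 / 3) + Finsupp.single y (1 / 3) +
    Finsupp.single z (1 / 3) - Finsupp.single p 1 with hD
  have hDx : D x = 1 / 3 := by simp [hD, hxy.symm, hxz.symm, hpx]
  have hDy : D y = 1 / 3 := by simp [hD, hxy, hyz.symm, hpy]
  have hDz : D z = 1 / 3 := by simp [hD, hxz, hyz, hpz]
  have hDp : D p = -1 := by simp [hD, hpx.symm, hpy.symm, hpz.symm]
  have hDo : ∀ i, i ≠ x → i ≠ y → i ≠ z → i ≠ p → D i = 0 := fun i h1 h2 h3 h4 => by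
    simp [hD, h1.symm, h2.symm, h3.symm, h4.symm]
  have hL : ∀ w : W →₀ ℝ,
      (LinearMap.id + (Finsupp.lapply (R := ℝ) p).smulRight D : (W →₀ ℝ) →ₗ[ℝ] (W →₀ ℝ)) w =
        w + w p • D := fun w => rfl
  refine of_push (LinearMap.id + (Finsupp.lapply (R := ℝ) p).smulRight D) ?_ ?_ ?_ ?_ ?_ ?_ ?_
  · exact Finset.card_eq_three.2 ⟨x, y, z, hxy, hxz, hyz, rfl⟩
  · rintro τ (rfl | rfl | rfl)
    · exact Finset.card_eq_three.2 ⟨x, y, p, hxy, hpx.symm, hpy.symm, rfl⟩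
    · exact Finset.card_eq_three.2 ⟨x, z, p, hxz, hpx.symm, hpz.symm, rfl⟩
    · exact Finset.card_eq_three.2 ⟨y, z, p, hyz, hpy.symm, hpz.symm, rfl⟩
  · rintro τ (rfl | rfl | rfl) i <;> simp only [Finset.mem_insert, Finset.mem_singleton,
      Set.mem_singleton_iff] <;> tauto
  · intro i
    have : Finsupp.linearCombination ℝ (fun _ => (1 : ℝ)) D = 0 := by
      simp [hD]; norm_num
    rw [hL]
    simp [this]
  · intro w hw
    rw [hL, hw p rfl, zero_smul, add_zero]
  · intro w hw τ hτ h0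
    have hp := hw p
    simp only [Finsupp.coe_zero, Pi.zero_apply] at hp
    have hpσ : (w + w p • D) p = 0 := by simp [hDp]
    refine ⟨fun i => ?_, fun i hi => ?_⟩
    · rw [hL]
      have hi := hw i
      simp only [Finsupp.coe_zero, Pi.zero_apply] at hi
      by_cases h4 : i = p
      · rw [h4, hpσ]; rfl
      · have : 0 ≤ D i := by
          by_cases h1 : i = x
          · rw [h1, hDx]; norm_num
          by_cases h2 : i = y
          · rw [h2, hDy]; norm_num
          by_cases h3 : i = z
          · rw [h3, hDz]; norm_num
          exact (hDo i h1 h2 h3 h4).ge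
        simp only [Finsupp.coe_zero, Pi.zero_apply, Finsupp.add_apply, Finsupp.smul_apply,
          smul_eq_mul]
        positivity
    · rw [hL]
      by_cases h4 : i = p
      · rw [h4, hpσ]
      simp only [Finset.mem_insert, Finset.mem_singleton, not_or] at hi
      have : w i = 0 := h0 i (by
        rcases hτ with rfl | rfl | rfl <;> simp [hi, h4])
      simp [this, hDo i hi.1 hi.2.1 hi.2.2 h4]
  · intro w w' hw hw' hF hF' he
    rw [hL, hL] at he
    have hz : ∀ w : W →₀ ℝ, ((∃ τ ∈ ({{x, y, p}, {x, z, p}, {y, z, p}} : Set (Finset W)),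
        ∀ i ∉ τ, w i = 0) ∨ (∀ i ∈ ({p} : Set W), w i = 0) ∧
        ∃ i ∈ ({x, y, z} : Finset W), w i = 0) → w x = 0 ∨ w y = 0 ∨ w z = 0 := by
      rintro w (⟨τ, rfl | rfl | rfl, h⟩ | ⟨-, i, hi, h⟩)
      · exact Or.inr (Or.inr (h z (by simp [hxz.symm, hyz.symm, hpz.symm])))
      · exact Or.inr (Or.inl (h y (by simp [hxy.symm, hyz, hpy.symm])))
      · exact Or.inl (h x (by simp [hxy, hxz, hpx.symm]))
      · simp only [Finset.mem_insert, Finset.mem_singleton] at hi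
        rcases hi with rfl | rfl | rfl <;> tauto
    have hpos : ∀ i, 0 ≤ w i := fun i => hw i
    have hpos' : ∀ i, 0 ≤ w' i := fun i => hw' i
    have hev : ∀ i, w i + w p * D i = w' i + w' p * D i := fun i => by
      simpa using DFunLike.congr_fun he i
    have ex := hev x
    have ey := hev y
    have ez := hev z
    rw [hDx] at ex
    rw [hDy] at ey
    rw [hDz] at ez
    have hpp : w p = w' p := by
      have h1 := hpos x; have h2 := hpos y; have h3 := hpos z
      have h4 := hpos' x; have h5 := hpos' y; have h6 := hpos' z
      rcases hz w hF with h | h | h <;> rcases hz w' hF' with h' | h' | h' <;> linarith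
    ext i
    have := hev i
    rw [hpp] at this
    linarith

theorem octahedron_weights_le {a b a' b' : Fin 3 → ℝ} (ha' : ∀ X, 0 ≤ a' X) (hb : ∀ X, 0 ≤ b X)
    (hb' : ∀ X, 0 ≤ b' X) (hab : ∀ X, a X = 0 ∨ b X = 0) (hab' : ∀ X, a' X = 0 ∨ b' X = 0)
    (hz : ∃ X, a X = 0)
    (he : ∀ X, a X - b X / 5 + 2 / 5 * (b 0 + b 1 + b 2) =
      a' X - b' X / 5 + 2 / 5 * (b' 0 + b' 1 + b' 2)) :
    b' 0 + b' 1 + b' 2 ≤ b 0 + b 1 + b 2 := by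
  by_contra! hlt
  have hmono : ∀ X, b X ≤ b' X := fun X => by
    have := he X; have := ha' X; have := hb X; have := hb' X
    rcases hab X with h | h <;> rcases hab' X with h' | h' <;> linarith
  obtain ⟨X, hX⟩ := hz
  have hgrow : b X + 2 * (b' 0 + b' 1 + b' 2 - (b 0 + b 1 + b 2)) ≤ b' X := by
    have := he X; have := ha' X
    linarith
  have h0 := hmono 0; have h1 := hmono 1; have h2 := hmono 2
  fin_cases X <;> simp at hgrow <;> linarith

theorem octahedron_weights {a b a' b' : Fin 3 → ℝ} (ha : ∀ X, 0 ≤ a X) (hb : ∀ X, 0 ≤ b X)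
    (ha' : ∀ X, 0 ≤ a' X) (hb' : ∀ X, 0 ≤ b' X)
    (hab : ∀ X, a X = 0 ∨ b X = 0) (hab' : ∀ X, a' X = 0 ∨ b' X = 0)
    (hz : ∃ X, a X = 0) (hz' : ∃ X, a' X = 0)
    (he : ∀ X, a X - b X / 5 + 2 / 5 * (b 0 + b 1 + b 2) =
      a' X - b' X / 5 + 2 / 5 * (b' 0 + b' 1 + b' 2)) (X : Fin 3) :
    a X = a' X ∧ b X = b' X := by
  have h1 := octahedron_weights_le ha' hb hb' hab hab' hz he
  have h2 := octahedron_weights_le ha hb' hb hab' hab hz' fun X => (he X).symm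
  have := he X; have := ha X; have := ha' X; have := hb X; have := hb' X
  rcases hab X with h | h <;> rcases hab' X with h' | h' <;> constructor <;> linarith

theorem octahedron_weights_zero [DecidableEq W] {h : Fin 3 → Bool → W} {w : W →₀ ℝ}
    (hh : ∀ X s Y s', h X s = h Y s' → X = Y ∧ s = s')
    (hw : (∃ τ ∈ (Set.range fun X : Fin 3 × Bool =>
        ({h X.1 X.2, h (X.1 + 1) !X.2, h (X.1 + 2) !X.2} : Finset W)), ∀ i ∉ τ, w i = 0) ∨
      (∀ i ∈ (Set.range fun X => h X true), w i = 0) ∧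
        ∃ i ∈ ({h 0 false, h 1 false, h 2 false} : Finset W), w i = 0) :
    (∀ X, w (h X false) = 0 ∨ w (h X true) = 0) ∧ ∃ X, w (h X false) = 0 := by
  have hfacet : ∀ (X Y : Fin 3) (s : Bool), ∃ s' : Bool,
      ¬(Y = X ∧ s' = s) ∧ ¬(Y = X + 1 ∧ s' = !s) ∧ ¬(Y = X + 2 ∧ s' = !s) := by
    decide
  have hfacet' : ∀ (X : Fin 3) (s : Bool), ∃ Y : Fin 3,
      ¬(Y = X ∧ false = s) ∧ ¬(Y = X + 1 ∧ false = !s) ∧ ¬(Y = X + 2 ∧ false = !s) := by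
    decide
  rcases hw with ⟨_, ⟨⟨X, s⟩, rfl⟩, h0⟩ | ⟨h0, i, hi, hi0⟩
  · have h0' : ∀ Y s', ¬(Y = X ∧ s' = s) → ¬(Y = X + 1 ∧ s' = !s) → ¬(Y = X + 2 ∧ s' = !s) →
        w (h Y s') = 0 := fun Y s' h1 h2 h3 => by
      refine h0 _ fun hmem => ?_
      simp only [Finset.mem_insert, Finset.mem_singleton] at hmem
      rcases hmem with h' | h' | h'
      · exact h1 (hh _ _ _ _ h')
      · exact h2 (hh _ _ _ _ h')
      · exact h3 (hh _ _ _ _ h')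
    refine ⟨fun Y => ?_, ?_⟩
    · obtain ⟨s', h1, h2, h3⟩ := hfacet X Y s
      cases s'
      · exact Or.inl (h0' Y _ h1 h2 h3)
      · exact Or.inr (h0' Y _ h1 h2 h3)
    · obtain ⟨Y, h1, h2, h3⟩ := hfacet' X s
      exact ⟨Y, h0' Y _ h1 h2 h3⟩
  · simp only [Finset.mem_insert, Finset.mem_singleton] at hi
    refine ⟨fun X => Or.inr (h0 (h X true) ⟨X, rfl⟩), ?_⟩
    rcases hi with rfl | rfl | rfl <;> exact ⟨_, hi0⟩

/-- Placing a triangle `h · true` inside the triangle `h · false` so that both span an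
octahedron. -/
theorem octahedron [DecidableEq W] {h : Fin 3 → Bool → W}
    (hh : ∀ X s Y s', h X s = h Y s' → X = Y ∧ s = s') :
    Fills {h 0 false, h 1 false, h 2 false} (Set.range fun X => h X true)
      (Set.range fun X : Fin 3 × Bool => {h X.1 X.2, h (X.1 + 1) !X.2, h (X.1 + 2) !X.2}) := by
  have hne : ∀ X s Y s', (X ≠ Y ∨ s ≠ s') → h X s ≠ h Y s' := fun X s Y s' hd he => by
    have := hh _ _ _ _ he
    tauto
  have hinj : ∀ X s Y s', h X s = h Y s' ↔ X = Y ∧ s = s' := fun X s Y s' =>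
    ⟨hh _ _ _ _, by rintro ⟨rfl, rfl⟩; rfl⟩
  set D : Fin 3 → W →₀ ℝ := fun X => Finsupp.single (h X false) (1 / 5) +
    Finsupp.single (h (X + 1) false) (2 / 5) + Finsupp.single (h (X + 2) false) (2 / 5) -
    Finsupp.single (h X true) 1 with hD
  have hDf : ∀ X Y, D X (h Y false) = if X = Y then 1 / 5 else 2 / 5 := by
    intro X Y
    fin_cases X <;> fin_cases Y <;> simp [hD, hinj]
  have hDt : ∀ X Y, D X (h Y true) = if X = Y then -1 else 0 := by
    intro X Y
    fin_cases X <;> fin_cases Y <;> simp [hD, hinj]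
  have hDo : ∀ X i, (∀ Y s, i ≠ h Y s) → D X i = 0 := fun X i hi => by
    simp [hD, (hi _ _).symm]
  have hsplit : ∀ i, (∃ Y s, i = h Y s) ∨ ∀ Y s, i ≠ h Y s := fun i => by
    by_cases hc : ∃ Y s, i = h Y s
    · exact Or.inl hc
    · push Not at hc
      exact Or.inr hc
  set L : (W →₀ ℝ) →ₗ[ℝ] (W →₀ ℝ) :=
    LinearMap.id + ∑ X, (Finsupp.lapply (R := ℝ) (h X true)).smulRight (D X)
  have hL : ∀ w : W →₀ ℝ, L w = w + ∑ X, w (h X true) • D X := fun w => by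
    simp [L]
  have hLi : ∀ w i, L w i = w i + (w (h 0 true) * D 0 i + w (h 1 true) * D 1 i +
      w (h 2 true) * D 2 i) := fun w i => by
    rw [hL]
    simp [Fin.sum_univ_three]
  have hLt : ∀ w Y, L w (h Y true) = 0 := fun w Y => by
    rw [hLi]
    fin_cases Y <;> simp [hDt]
  have hLo : ∀ w i, (∀ Y s, i ≠ h Y s) → L w i = w i := fun w i hi => by
    rw [hLi]
    simp [hDo _ i hi]
  have hLf : ∀ w Y, L w (h Y false) = w (h Y false) + (w (h Y true) * (1 / 5) +
      w (h (Y + 1) true) * (2 / 5) + w (h (Y + 2) true) * (2 / 5)) := fun w Y => by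
    rw [hLi]
    fin_cases Y <;> simp [hDf] <;> ring
  refine of_push L ?_ ?_ ?_ ?_ ?_ ?_ ?_
  · exact Finset.card_eq_three.2 ⟨_, _, _, hne _ _ _ _ (by simp), hne _ _ _ _ (by simp),
      hne _ _ _ _ (by simp), rfl⟩
  · rintro _ ⟨⟨X, s⟩, rfl⟩
    exact Finset.card_eq_three.2 ⟨_, _, _, hne _ _ _ _ (by simp), hne _ _ _ _ (by simp),
      hne _ _ _ _ (by simp), rfl⟩
  · have : ∀ Y s, h Y s ∈ ({h 0 false, h 1 false, h 2 false} : Finset W) ∨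
        h Y s ∈ Set.range fun X => h X true := by
      intro Y s
      cases s
      · left
        fin_cases Y <;> simp
      · exact Or.inr ⟨Y, rfl⟩
    rintro _ ⟨⟨X, s⟩, rfl⟩ i hi
    simp only [Finset.mem_insert, Finset.mem_singleton] at hi
    rcases hi with rfl | rfl | rfl <;> exact this _ _
  · intro i
    have : ∀ X, Finsupp.linearCombination ℝ (fun _ => (1 : ℝ)) (D X) = 0 := fun X => by
      simp [hD]; norm_num
    rw [hL]
    simp [this]
  · intro w hw
    rw [hL]
    simp [hw _ ⟨_, rfl⟩]
  · intro w hw τ hτ h0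
    have hpos : ∀ i, 0 ≤ w i := fun i => hw i
    refine ⟨fun i => ?_, fun i hi => ?_⟩
    · change 0 ≤ L w i
      rcases hsplit i with ⟨Y, s, rfl⟩ | ho
      · cases s
        · rw [hLf]
          have := hpos (h Y false)
          have := hpos (h Y true)
          have := hpos (h (Y + 1) true)
          have := hpos (h (Y + 2) true)
          positivity
        · rw [hLt]
      · rw [hLo _ _ ho]
        exact hpos i
    · rcases hsplit i with ⟨Y, s, rfl⟩ | ho
      · cases s
        · exfalso
          apply hi
          fin_cases Y <;> simp
        · exact hLt _ _
      · rw [hLo _ _ ho]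
        apply h0
        obtain ⟨⟨X, s⟩, rfl⟩ := hτ
        simp [ho]
  · intro w w' hw hw' hF hF' he
    have hz := fun w => octahedron_weights_zero (w := w) hh
    have hpos : ∀ i, 0 ≤ w i := fun i => hw i
    have hpos' : ∀ i, 0 ≤ w' i := fun i => hw' i
    have hev : ∀ i, L w i = L w' i := fun i => by rw [he]
    have key : ∀ X s, w (h X s) = w' (h X s) := by
      have hpt := octahedron_weights (a := fun X => w (h X false)) (b := fun X => w (h X true))
        (a' := fun X => w' (h X false)) (b' := fun X => w' (h X true))
        (fun _ => hpos _) (fun _ => hpos _) (fun _ => hpos' _) (fun _ => hpos' _)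
        (hz w hF).1 (hz w' hF').1 (hz w hF).2 (hz w' hF').2 ?_
      · intro X s
        cases s
        · exact (hpt X).1
        · exact (hpt X).2
      · intro X
        have e := hev (h X false)
        rw [hLf, hLf] at e
        fin_cases X <;> simp at e ⊢ <;> linarith
    ext i
    rcases hsplit i with ⟨Y, s, rfl⟩ | ho
    · exact key Y s
    · rw [← hLo w i ho, ← hLo w' i ho, he]

/-- Placing a path inside a triangle, all of whose vertices see the edge `x y`. -/
theorem fan [DecidableEq W] {x y : W} {q : ℕ → W} (hxy : x ≠ y) (hx : ∀ k, q k ≠ x)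
    (hy : ∀ k, q k ≠ y) (hq : Function.Injective q) (m : ℕ) :
    Fills {x, y, q 0} {a | ∃ k < m, a = q (k + 1)}
      (insert {x, y, q m} ({τ | ∃ k < m, τ = {x, q k, q (k + 1)}} ∪
        {τ | ∃ k < m, τ = {y, q k, q (k + 1)}})) := by
  induction m with
  | zero =>
    have : ({x, y, q 0} : Finset W).card = 3 :=
      Finset.card_eq_three.2 ⟨x, y, q 0, hxy, (hx 0).symm, (hy 0).symm, rfl⟩
    refine ⟨this, ?_, ?_, ?_⟩
    · simp [this]
    · simp
    · simp
  | succ m ih =>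
    refine (ih.andThen ?_ (star hxy (hx m).symm (hy m).symm (hx (m + 1)) (hy (m + 1))
      (hq.ne (by omega))) ?_).mono ?_ ?_
    · rintro (⟨k, -, hk⟩ | ⟨k, -, hk⟩)
      · have : y ∈ ({x, q k, q (k + 1)} : Finset W) := hk ▸ by simp
        simp [hxy.symm, (hy _).symm] at this
      · have : x ∈ ({y, q k, q (k + 1)} : Finset W) := hk ▸ by simp
        simp [hxy, (hx _).symm] at this
    · rintro a rfl
      simp [hx, hy, hq.eq_iff]
    · rintro a (⟨k, hk, rfl⟩ | rfl)
      · exact ⟨k, by omega, rfl⟩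
      · exact ⟨m, by omega, rfl⟩
    · rintro τ (rfl | ⟨k, hk, rfl⟩ | ⟨k, hk, rfl⟩)
      · exact Or.inr (Or.inl rfl)
      · rcases Nat.lt_succ_iff_lt_or_eq.1 hk with hk | rfl
        · exact Or.inl (Or.inl ⟨k, hk, rfl⟩)
        · exact Or.inr (Or.inr (Or.inl rfl))
      · rcases Nat.lt_succ_iff_lt_or_eq.1 hk with hk | rfl
        · exact Or.inl (Or.inr ⟨k, hk, rfl⟩)
        · exact Or.inr (Or.inr (Or.inr rfl))

end Fills

theorem realizable_triangle {W : Type*} [DecidableEq W] {x y z : W} (hxy : x ≠ y) (hxz : x ≠ z)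
    (hyz : y ≠ z) : Realizable ({{x, y, z}} : Set (Finset W)) := by
  refine ⟨fun i => (if i = x then (0, 0) else if i = y then (1, 0) else (0, 1), 1),
    fun _ => rfl, ?_⟩
  have hform : ∀ w : W →₀ ℝ, (∀ i ∉ ({x, y, z} : Finset W), w i = 0) →
      w = Finsupp.single x (w x) + Finsupp.single y (w y) + Finsupp.single z (w z) := by
    intro w hw
    ext i
    by_cases h1 : i = x
    · simp [h1, hxy.symm, hxz.symm]
    by_cases h2 : i = y
    · simp [h2, hxy, hyz.symm]
    by_cases h3 : i = z
    · simp [h3, hxz, hyz]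
    rw [hw i (by simp [h1, h2, h3])]
    simp [Ne.symm h1, Ne.symm h2, Ne.symm h3]
  rintro w w' ⟨-, _, rfl, h0⟩ ⟨-, _, rfl, h0'⟩ he
  rw [hform w h0, hform w' h0'] at he ⊢
  simp [hxy.symm, hxz.symm, hyz.symm] at he
  obtain ⟨⟨h1, h2⟩, h3⟩ := he
  rw [h1, h2] at h3 ⊢
  have : w x = w' x := by linarith
  rw [this]

theorem Realizable.isPlanar {V W : Type*} {Δ : Set (Finset W)} (hΔ : Realizable Δ)
    {G : SimpleGraph V} {ι : V → W} (hι : Function.Injective ι) (hv : ∀ v, ∃ τ ∈ Δ, ι v ∈ τ)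
    (hG : ∀ u v, G.Adj u v → ∃ τ ∈ Δ, ι u ∈ τ ∧ ι v ∈ τ) : G.IsPlanar := by
  obtain ⟨f, hf, hinj⟩ := hΔ
  set wt : V → V → ℝ → W →₀ ℝ := fun u v t =>
    Finsupp.single (ι u) (1 - t) + Finsupp.single (ι v) t with hwt
  have hadm : ∀ u v, G.Adj u v → ∀ t ∈ unitInterval, Admissible Δ (wt u v t) := by
    intro u v h t ht
    obtain ⟨τ, hτ, hu, hv⟩ := hG u v h
    refine ⟨add_nonneg (Finsupp.single_nonneg.2 (by linarith [ht.2]))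
      (Finsupp.single_nonneg.2 ht.1), τ, hτ, fun i hi => ?_⟩
    have h1 : ι u ≠ i := by rintro rfl; exact hi hu
    have h2 : ι v ≠ i := by rintro rfl; exact hi hv
    simp [hwt, h1.symm, h2.symm]
  have hadm' : ∀ v, Admissible Δ (Finsupp.single (ι v) 1) := by
    intro v
    obtain ⟨τ, hτ, hv⟩ := hv v
    refine ⟨Finsupp.single_nonneg.2 zero_le_one, τ, hτ, fun i hi => ?_⟩
    have h2 : ι v ≠ i := by rintro rfl; exact hi hv
    simp [h2.symm]
  set p : V → ℝ × ℝ := fun v => (f (ι v)).1 with hp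
  have hcomb : ∀ u v t, Finsupp.linearCombination ℝ f (wt u v t) =
      ((1 - t) • p u + t • p v, 1) := by
    intro u v t
    ext <;> simp [hwt, hp, hf] <;> ring
  have hcomb' : ∀ v, Finsupp.linearCombination ℝ f (Finsupp.single (ι v) 1) = (p v, 1) := by
    intro v
    ext <;> simp [hp, hf]
  have hne : ∀ {u v}, G.Adj u v → ι u ≠ ι v := fun h => hι.ne h.ne
  have hleft : ∀ {u v}, G.Adj u v → ∀ t, wt u v t (ι u) = 1 - t := fun h t => by
    simp [hwt, hne h]
  have hright : ∀ {u v}, G.Adj u v → ∀ t, wt u v t (ι v) = t := fun h t => by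
    simp [hwt, (hne h).symm]
  have hother : ∀ {u v w} t, wt u v t (ι w) ≠ 0 → w = u ∨ w = v := by
    intro u v w t h
    by_contra! hcon
    exact h (by simp [hwt, hι.eq_iff, hcon])
  refine ⟨p, fun u v h => ?_, fun u v _ =>
    { toFun := fun t => (1 - (t : ℝ)) • p u + (t : ℝ) • p v
      continuous_toFun := by fun_prop
      source' := by simp
      target' := by simp }, ?_, ?_, ?_⟩
  · have := hinj _ _ (hadm' u) (hadm' v) (by rw [hcomb', hcomb', h])
    exact hι (Finsupp.single_left_injective one_ne_zero this)
  · intro u v h s t hst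
    have := hinj _ _ (hadm u v h s s.2) (hadm u v h t t.2)
      (by rw [hcomb, hcomb]; exact congrArg (·, (1 : ℝ)) hst)
    have := DFunLike.congr_fun this (ι v)
    rw [hright h, hright h] at this
    exact Subtype.ext this
  · intro u v h t h0 h1 w hw
    have := hinj _ _ (hadm u v h t t.2) (hadm' w)
      (by rw [hcomb, hcomb']; exact congrArg (·, (1 : ℝ)) hw)
    have e1 := DFunLike.congr_fun this (ι u)
    have e2 := DFunLike.congr_fun this (ι v)
    rw [hleft h] at e1
    rw [hright h] at e2
    have h0' : (t : ℝ) ≠ 0 := fun h' => h0 (Subtype.ext h')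
    have h1' : (1 - t : ℝ) ≠ 0 := fun h' => h1 (Subtype.ext (sub_eq_zero.1 h').symm)
    have wu : w = u := by
      by_contra hc
      rw [Finsupp.single_eq_of_ne (hι.ne (Ne.symm hc))] at e1
      exact h1' e1
    have wv : w = v := by
      by_contra hc
      rw [Finsupp.single_eq_of_ne (hι.ne (Ne.symm hc))] at e2
      exact h0' e2
    exact h.ne (wu.symm.trans wv)
  · intro u v u' v' h h' hd s t h0 h1 hst
    have := hinj _ _ (hadm u v h s s.2) (hadm u' v' h' t t.2)
      (by rw [hcomb, hcomb]; exact congrArg (·, (1 : ℝ)) hst)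
    have h0' : (s : ℝ) ≠ 0 := fun h' => h0 (Subtype.ext h')
    have h1' : (1 - s : ℝ) ≠ 0 := fun h' => h1 (Subtype.ext (sub_eq_zero.1 h').symm)
    have hu := hother (u := u') (v := v') (w := u) t (by rw [← this, hleft h]; exact h1')
    have hv := hother (u := u') (v := v') (w := v) t (by rw [← this, hright h]; exact h0')
    have := h.ne
    apply hd
    rcases hu with rfl | rfl <;> rcases hv with rfl | rfl <;> simp_all [Sym2.eq_swap]

/-- If any two colors meet in some pair of vertices allowed by `H`, then choosing one pair for any
two colors yields a graph whose achromatic and pseudoachromatic numbers are the number of colors. -/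
theorem exists_le_achromatic_eq {V : Type*} {k : ℕ} (hk : 2 ≤ k) (c : V → Fin k)
    (H : V → V → Prop) (hsymm : ∀ u v, H u v → H v u)
    (hc : ∀ i j, i ≠ j → ∃ u v, H u v ∧ c u = i ∧ c v = j) :
    ∃ G : SimpleGraph V, (∀ u v, G.Adj u v → H u v) ∧ G.achromatic = k ∧
      G.pseudoachromatic = k := by
  have : NeZero k := ⟨by omega⟩
  have : Nonempty V := by
    obtain ⟨u, -⟩ := hc ⟨0, by omega⟩ ⟨1, by omega⟩ (by simp)
    exact ⟨u⟩
  choose! a b hab ha hb using hc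
  set G : SimpleGraph V :=
    { Adj := fun u v => ∃ i j, i < j ∧ (u = a i j ∧ v = b i j ∨ u = b i j ∧ v = a i j)
      symm := ⟨by rintro u v ⟨i, j, hij, h | h⟩ <;> exact ⟨i, j, hij, by tauto⟩⟩
      loopless := ⟨by
        rintro u ⟨i, j, hij, ⟨h1, h2⟩ | ⟨h2, h1⟩⟩ <;>
          exact hij.ne ((ha i j hij.ne).symm.trans (by rw [← h1, h2]; exact hb i j hij.ne))⟩ }
  have hproper : G.IsProperColoring c := by
    rintro u v ⟨i, j, hij, ⟨rfl, rfl⟩ | ⟨rfl, rfl⟩⟩ <;> rw [ha i j hij.ne, hb i j hij.ne]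
    · exact hij.ne
    · exact hij.ne'
  have hcolors : ∀ i j, i ≠ j → ∃ u v, G.Adj u v ∧ c u = i ∧ c v = j := by
    intro i j hij
    rcases lt_or_gt_of_ne hij with h | h
    · exact ⟨_, _, ⟨i, j, h, Or.inl ⟨rfl, rfl⟩⟩, ha i j hij, hb i j hij⟩
    · exact ⟨_, _, ⟨j, i, h, Or.inr ⟨rfl, rfl⟩⟩, hb j i hij.symm, ha j i hij.symm⟩
  have hcomplete : G.IsCompleteColoring c := by
    refine ⟨fun i => ?_, hcolors⟩
    have : Nontrivial (Fin k) := Fin.nontrivial_iff_two_le.2 hk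
    obtain ⟨j, hj⟩ := exists_ne i
    obtain ⟨u, -, -, hu, -⟩ := hcolors i j hj.symm
    exact ⟨u, hu⟩
  have hinj : ∀ u v u' v', G.Adj u v → G.Adj u' v' → c u = c u' → c v = c v' →
      u = u' ∧ v = v' := by
    rintro u v u' v' ⟨i, j, hij, ⟨rfl, rfl⟩ | ⟨rfl, rfl⟩⟩
      ⟨i', j', hij', ⟨rfl, rfl⟩ | ⟨rfl, rfl⟩⟩ h1 h2 <;>
      simp only [ha i j hij.ne, hb i j hij.ne, ha i' j' hij'.ne, hb i' j' hij'.ne] at h1 h2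
    · subst h1 h2; exact ⟨rfl, rfl⟩
    · exact absurd (h1 ▸ h2 ▸ hij) hij'.asymm
    · exact absurd (h1 ▸ h2 ▸ hij) hij'.asymm
    · subst h1 h2; exact ⟨rfl, rfl⟩
  have hbound : ∀ m (c' : V → Fin m), G.IsCompleteColoring c' → m ≤ k := by
    intro m c' hc'
    by_contra! hlt
    choose! a' b' hadj ha' hb' using hc'.2
    have hcard : (Finset.univ : Finset (Fin m)).offDiag.card ≤
        (Finset.univ : Finset (Fin k)).offDiag.card := by
      refine Finset.card_le_card_of_injOn (fun x => (c (a' x.1 x.2), c (b' x.1 x.2))) ?_ ?_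
      · intro x hx
        simp only [Finset.coe_offDiag, Set.mem_offDiag, Finset.mem_coe, Finset.mem_univ,
          true_and] at hx ⊢
        exact hproper (hadj _ _ hx)
      · intro x hx y hy he
        simp only [Finset.coe_offDiag, Set.mem_offDiag, Finset.mem_coe, Finset.mem_univ,
          true_and] at hx hy
        simp only [Prod.mk.injEq] at he
        obtain ⟨h1, h2⟩ := hinj _ _ _ _ (hadj _ _ hx) (hadj _ _ hy) he.1 he.2
        ext1
        · rw [← ha' _ _ hx, ← ha' _ _ hy, h1]
        · rw [← hb' _ _ hx, ← hb' _ _ hy, h2]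
    simp only [Finset.offDiag_card, Finset.card_univ, Fintype.card_fin] at hcard
    have h1 : k * k - k = k * (k - 1) := by rw [Nat.mul_sub, mul_one]
    have h2 : m * m - m = m * (m - 1) := by rw [Nat.mul_sub, mul_one]
    rw [h1, h2] at hcard
    have : k * (k - 1) < m * (m - 1) :=
      Nat.mul_lt_mul_of_lt_of_le hlt (by omega) (by omega)
    omega
  refine ⟨G, ?_, IsGreatest.csSup_eq ⟨⟨c, hproper, hcomplete⟩, ?_⟩,
    IsGreatest.csSup_eq ⟨⟨c, hcomplete⟩, ?_⟩⟩
  · rintro u v ⟨i, j, hij, ⟨rfl, rfl⟩ | ⟨rfl, rfl⟩⟩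
    · exact hab i j hij.ne
    · exact hsymm _ _ (hab i j hij.ne)
  · rintro m ⟨c', -, hc'⟩
    exact hbound m c' hc'
  · rintro m ⟨c', hc'⟩
    exact hbound m c' hc'

/-- Vertices of the construction. The vertex `path r X s 0` is called a hub of group `r`. -/
inductive Node where
  | apex : Node
  | top : Node
  | sep (k : ℕ) : Node
  | path (r : ℕ) (X : Fin 3) (s : Bool) (k : ℕ) : Node
  | extra (r : ℕ) (X : Fin 3) : Node

namespace Node

noncomputable instance : DecidableEq Node := Classical.decEq _

/-- Vertices inside the `r`-th triangle at the apex. -/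
def group (r : ℕ) : Set Node :=
  {a | (∃ X s k, a = path r X s k) ∨ ∃ X, a = extra r X}

/-- The triangles inside the `r`-th triangle at the apex. -/
def groupFacets (m r : ℕ) : Set (Finset Node) :=
  {τ | (∃ X, τ = {apex, path r X false 0, extra r X}) ∨ ∃ X s,
    τ = {path r (X + 1) (!s) 0, path r (X + 2) (!s) 0, path r X s m} ∨
    ∃ Y ∈ ({X + 1, X + 2} : Set (Fin 3)), ∃ k < m,
      τ = {path r Y (!s) 0, path r X s k, path r X s (k + 1)}}

theorem fills_hubs (r : ℕ) :
    Fills {apex, sep r, sep (r + 1)} {a | ∃ X s, a = path r X s 0}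
      ({{apex, sep r, path r 0 false 0}, {apex, sep (r + 1), path r 1 false 0},
        {apex, path r 0 false 0, path r 2 false 0}} ∪
      Set.range fun X : Fin 3 × Bool => {path r X.1 X.2 0, path r (X.1 + 1) (!X.2) 0,
        path r (X.1 + 2) (!X.2) 0}) := by
  have s1 := Fills.star (x := apex) (y := sep r) (z := sep (r + 1)) (p := path r 0 false 0)
    (by simp) (by simp) (by simp) (by simp) (by simp) (by simp)
  have s2 := (s1.mono (F' := insert {apex, sep (r + 1), path r 0 false 0}
    {{apex, sep r, path r 0 false 0}}) subset_rfl (by intro τ; simp; tauto)).andThen (by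
      intro h
      simpa using Finset.ext_iff.1 (Set.mem_singleton_iff.1 h) (sep r))
    (Fills.star (p := path r 1 false 0) (by simp) (by simp) (by simp) (by simp) (by simp)
      (by simp)) (by simp)
  have s3 := (s2.mono (F' := insert {apex, path r 0 false 0, path r 1 false 0}
    {{apex, sep r, path r 0 false 0}, {apex, sep (r + 1), path r 1 false 0}}) subset_rfl
    (by intro τ; simp; tauto)).andThen (by
      rintro (h | h)
      · simpa using Finset.ext_iff.1 h (sep r)
      · simpa using Finset.ext_iff.1 (Set.mem_singleton_iff.1 h) (sep (r + 1)))
    (Fills.star (p := path r 2 false 0) (by simp) (by simp) (by simp) (by simp) (by simp)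
      (by simp)) (by simp)
  have s4 := (s3.mono (F' := insert {path r 0 false 0, path r 1 false 0, path r 2 false 0}
    {{apex, sep r, path r 0 false 0}, {apex, sep (r + 1), path r 1 false 0},
      {apex, path r 0 false 0, path r 2 false 0}}) subset_rfl (by intro τ; simp; tauto)).andThen
    (by
      rintro (h | h | h)
      all_goals simpa using Finset.ext_iff.1 h apex)
    (Fills.octahedron (h := fun X s => path r X s 0) (by simp)) (by simp)
  refine s4.mono ?_ subset_rfl
  rintro a (((rfl | rfl) | rfl) | ⟨X, rfl⟩) <;> exact ⟨_, _, rfl⟩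

theorem fills_group (m r : ℕ) :
    Fills {apex, sep r, sep (r + 1)} (group r) (groupFacets m r) := by
  set τ : Fin 3 ⊕ Fin 3 × Bool → Finset Node := Sum.elim
    ![{apex, sep r, path r 0 false 0}, {apex, sep (r + 1), path r 1 false 0},
        {apex, path r 0 false 0, path r 2 false 0}]
    fun X => {path r (X.1 + 1) (!X.2) 0, path r (X.1 + 2) (!X.2) 0, path r X.1 X.2 0} with hτ
  have hinj : Function.Injective τ := by
    refine Function.Injective.sumElim ?_ ?_ ?_
    · intro X Y h
      have h1 := Finset.ext_iff.1 h (sep r)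
      have h2 := Finset.ext_iff.1 h (sep (r + 1))
      fin_cases X <;> fin_cases Y <;> simp at h1 h2 ⊢
    · rintro ⟨X, s⟩ ⟨Y, s'⟩ h
      have h1 := fun Z z => Finset.ext_iff.1 h (path r Z z 0)
      simp only [Finset.mem_insert, Finset.mem_singleton, path.injEq, true_and, and_true] at h1
      clear h hτ τ
      revert X s Y s'
      decide
    · rintro X ⟨Y, s⟩ h
      have := Finset.ext_iff.1 h apex
      fin_cases X <;> simp at this
  set M : Fin 3 ⊕ Fin 3 × Bool → Set Node := Sum.elim (fun X => {extra r X})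
    fun X => {a | ∃ k < m, a = path r X.1 X.2 (k + 1)} with hM
  set G : Fin 3 ⊕ Fin 3 × Bool → Set (Finset Node) := Sum.elim
    (fun X => {{apex, path r X false 0, extra r X}})
    fun X => {τ | τ = {path r (X.1 + 1) (!X.2) 0, path r (X.1 + 2) (!X.2) 0, path r X.1 X.2 m} ∨
      ∃ Y ∈ ({X.1 + 1, X.1 + 2} : Set (Fin 3)), ∃ k < m,
        τ = {path r Y (!X.2) 0, path r X.1 X.2 k, path r X.1 X.2 (k + 1)}} with hG
  have := ((fills_hubs r).mono (F' := ∅ ∪ Set.range τ) subset_rfl ?_).bind hinj (by simp)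
    (M := M) (G := G) ?_ ?_ ?_
  · refine this.mono ?_ ?_
    · rintro a (⟨X, s, rfl⟩ | ha)
      · exact Or.inl ⟨_, _, _, rfl⟩
      · obtain ⟨X | ⟨X, s⟩, ha⟩ := Set.mem_iUnion.1 ha
        · exact Or.inr ⟨X, ha⟩
        · obtain ⟨k, -, rfl⟩ := ha
          exact Or.inl ⟨_, _, _, rfl⟩
    · rintro ρ (⟨X, hX⟩ | ⟨X, s, hX⟩)
      · exact Or.inr (Set.mem_iUnion.2 ⟨Sum.inl X, hX⟩)
      · exact Or.inr (Set.mem_iUnion.2 ⟨Sum.inr (X, s), hX⟩)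
  · rintro ρ (⟨⟨⟩⟩ | ⟨X | ⟨X, s⟩, rfl⟩)
    · left
      fin_cases X <;> simp [hτ]
    · right
      refine ⟨(X, s), ?_⟩
      ext a
      simp [hτ]
      tauto
  · rintro (X | ⟨X, s⟩)
    · have h0 : ∀ x y z w : Node, x ≠ y → x ≠ z → y ≠ z → w ≠ x → w ≠ y → w ≠ z →
        Fills {x, y, z} {w} {{x, z, w}} := fun x y z w h1 h2 h3 h4 h5 h6 =>
          (Fills.star h1 h2 h3 h4 h5 h6).mono subset_rfl (by simp)
      fin_cases X <;> exact h0 _ _ _ _ (by simp) (by simp) (by simp) (by simp) (by simp) (by simp)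
    · refine (Fills.fan (q := fun k => path r X s k) (by simp) (by simp) (by simp)
        (fun _ _ h => by simpa using h) m).mono subset_rfl ?_
      rintro ρ (rfl | ⟨Y, rfl | rfl, k, hk, rfl⟩)
      · exact Or.inl rfl
      · exact Or.inr (Or.inl ⟨k, hk, rfl⟩)
      · exact Or.inr (Or.inr ⟨k, hk, rfl⟩)
  · rintro (X | X) (Y | Y) hXY a ha ha'
    · have h1 : a = extra r X := ha
      have h2 : a = extra r Y := ha'
      exact hXY (by simpa [h1] using h2)
    · obtain ⟨k, -, h2⟩ := ha'
      have h1 : a = extra r X := ha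
      simp [h1] at h2
    · obtain ⟨k, -, h1⟩ := ha
      have h2 : a = extra r Y := ha'
      simp [h1] at h2
    · obtain ⟨k, -, h1⟩ := ha
      obtain ⟨k', -, h2⟩ := ha'
      rw [h1, path.injEq] at h2
      exact hXY (congrArg _ (Prod.ext h2.2.1 h2.2.2.1))
  · rintro (X | X) a ha
    · rw [show a = extra r X from ha]
      simp
    · obtain ⟨k, -, rfl⟩ := ha
      simp

/-- All triangles of the construction with `t` groups. -/
def facets (t : ℕ) : Set (Finset Node) :=
  ⋃ r : Fin t, groupFacets (t - 1) r

theorem realizable_facets (t : ℕ) : Realizable (facets t) := by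
  have h := Fills.fan (x := apex) (y := top) (q := sep) (by simp) (by simp) (by simp)
    (fun _ _ h => by simpa using h) t
  have := (h.mono (F' := ∅ ∪ Set.range fun r : Fin t => {apex, sep r, sep (r + 1)}) subset_rfl
    (by
      rintro _ (⟨⟨⟩⟩ | ⟨r, rfl⟩)
      exact Or.inr (Or.inl ⟨r, r.2, rfl⟩))).bind ?_ (by simp)
    (fun r => fills_group (t - 1) r) ?_ ?_
  · simpa [facets] using this.realizable ∅ (by simp) (by simp) (by simp)
      (by simpa using realizable_triangle (by simp) (by simp) (by simp))
  · intro r r' hr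
    have h1 := Finset.ext_iff.1 hr (sep r)
    have h2 := Finset.ext_iff.1 hr (sep r')
    simp at h1 h2
    ext
    omega
  · rintro r r' hr a (⟨X, s, k, rfl⟩ | ⟨X, rfl⟩) <;> simp [group] <;> omega
  · rintro r a (⟨X, s, k, rfl⟩ | ⟨X, rfl⟩) <;> simp

end Node

namespace Node

/-- Two vertices that lie in a common triangle of the construction. -/
def Near (t : ℕ) (a b : Node) : Prop :=
  ∃ τ ∈ facets t, a ∈ τ ∧ b ∈ τ

theorem Near.symm {t : ℕ} {a b : Node} : Near t a b → Near t b a := fun ⟨τ, hτ, ha, hb⟩ =>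
  ⟨τ, hτ, hb, ha⟩

theorem near_of_mem_groupFacets {t r : ℕ} (hr : r < t) {τ : Finset Node} {a b : Node}
    (hτ : τ ∈ groupFacets (t - 1) r) (ha : a ∈ τ) (hb : b ∈ τ) : Near t a b :=
  ⟨τ, Set.mem_iUnion.2 ⟨⟨r, hr⟩, hτ⟩, ha, hb⟩

theorem near_apex_hub {t r : ℕ} (hr : r < t) (X : Fin 3) : Near t apex (path r X false 0) :=
  near_of_mem_groupFacets hr (Or.inl ⟨X, rfl⟩) (by simp) (by simp)

theorem near_apex_extra {t r : ℕ} (hr : r < t) (X : Fin 3) : Near t apex (extra r X) :=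
  near_of_mem_groupFacets hr (Or.inl ⟨X, rfl⟩) (by simp) (by simp)

theorem near_extra_hub {t r : ℕ} (hr : r < t) (X : Fin 3) : Near t (extra r X) (path r X false 0) :=
  near_of_mem_groupFacets hr (Or.inl ⟨X, rfl⟩) (by simp) (by simp)

theorem near_path_succ {t r : ℕ} (hr : r < t) (X : Fin 3) (s : Bool) {k : ℕ} (hk : k + 1 < t) :
    Near t (path r X s k) (path r X s (k + 1)) :=
  near_of_mem_groupFacets hr (Or.inr ⟨X, s, Or.inr ⟨X + 1, Or.inl rfl, k, by omega, rfl⟩⟩)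
    (by simp) (by simp)

theorem near_path_hub {t r : ℕ} (hr : r < t) {X Y : Fin 3} (hXY : Y ≠ X) (s : Bool) {k : ℕ}
    (hk : k < t) :
    Near t (path r X s k) (path r Y (!s) 0) := by
  have hY : Y = X + 1 ∨ Y = X + 2 := by
    revert X Y
    decide
  by_cases h : k < t - 1
  · exact near_of_mem_groupFacets hr (Or.inr ⟨X, s, Or.inr ⟨Y, hY, k, h, rfl⟩⟩)
      (by simp) (by simp)
  · obtain rfl : k = t - 1 := by omega
    refine near_of_mem_groupFacets hr (Or.inr ⟨X, s, Or.inl rfl⟩) (by simp) ?_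
    rcases hY with rfl | rfl <;> simp

theorem near_hub_hub {t r : ℕ} (hr : r < t) {X Y : Fin 3} (hXY : X ≠ Y) (s : Bool) :
    Near t (path r X s 0) (path r Y s 0) := by
  have hZ : ∃ Z : Fin 3, (X = Z + 1 ∨ X = Z + 2) ∧ (Y = Z + 1 ∨ Y = Z + 2) := by
    revert X Y
    decide
  obtain ⟨Z, hX, hY⟩ := hZ
  refine near_of_mem_groupFacets hr (Or.inr ⟨Z, !s, Or.inl rfl⟩) ?_ ?_
  · rcases hX with rfl | rfl <;> simp
  · rcases hY with rfl | rfl <;> simp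

/-- The zigzag order `0, t - 1, 1, t - 2, …` of the offsets along a path. -/
def offset (t k : ℕ) : ℕ :=
  if k % 2 = 0 then k / 2 else t - 1 - k / 2

theorem exists_offset_eq {t o : ℕ} (ho : o < t) : ∃ k < t, offset t k = o := by
  by_cases h : 2 * o < t
  · exact ⟨2 * o, h, by simp [offset]⟩
  · refine ⟨2 * (t - 1 - o) + 1, by omega, ?_⟩
    rw [offset, if_neg (by omega)]
    omega

/-- The half turn of `ZMod (2 * t)` for `true`, and `0` for `false`. -/
def shift (t : ℕ) (s : Bool) : ZMod (2 * t) :=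
  if s then t else 0

theorem shift_not (t : ℕ) (s : Bool) : shift t (!s) = shift t s + t := by
  have : (t : ZMod (2 * t)) + t = 0 := by
    rw [← two_mul]
    exact_mod_cast ZMod.natCast_self (2 * t)
  cases s <;> simp [shift, this]

theorem exists_eq_add_shift {t : ℕ} (ht : 1 ≤ t) (i : ZMod (2 * t)) :
    ∃ r < t, ∃ s, i = r + shift t s := by
  have : NeZero (2 * t) := ⟨by omega⟩
  have hi := ZMod.val_lt i
  by_cases h : i.val < t
  · exact ⟨i.val, h, false, by simp [shift]⟩
  · refine ⟨i.val - t, by omega, true, ?_⟩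
    rw [shift, if_pos rfl, ← Nat.cast_add, Nat.sub_add_cancel (by omega), ZMod.natCast_zmod_val]

/-- The coloring of the construction. -/
def color (t : ℕ) : Node → Option (Fin 3 × ZMod (2 * t))
  | apex => none
  | top => none
  | sep _ => none
  | path r X s k => some (X, r + shift t s - offset t k)
  | extra r X => some (X, r + t)

theorem color_hub (t r : ℕ) (X : Fin 3) (s : Bool) :
    color t (path r X s 0) = some (X, r + shift t s) := by
  simp [color, offset]

/-- Two colors that occur on vertices of a common triangle. -/
def Meet (t : ℕ) (c c' : Option (Fin 3 × ZMod (2 * t))) : Prop :=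
  ∃ a b, Near t a b ∧ color t a = c ∧ color t b = c'

theorem Meet.symm {t : ℕ} {c c' : Option (Fin 3 × ZMod (2 * t))} : Meet t c c' → Meet t c' c :=
  fun ⟨a, b, h, ha, hb⟩ => ⟨b, a, h.symm, hb, ha⟩

theorem meet_none {t : ℕ} (ht : 1 ≤ t) (X : Fin 3) (i : ZMod (2 * t)) :
    Meet t none (some (X, i)) := by
  obtain ⟨r, hr, s, rfl⟩ := exists_eq_add_shift ht i
  cases s
  · exact ⟨_, _, near_apex_hub hr X, rfl, color_hub _ _ _ _⟩
  · exact ⟨_, _, near_apex_extra hr X, rfl, rfl⟩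

theorem meet_antipodal {t : ℕ} (ht : 1 ≤ t) (X : Fin 3) (i : ZMod (2 * t)) :
    Meet t (some (X, i + t)) (some (X, i)) := by
  obtain ⟨r, hr, s, rfl⟩ := exists_eq_add_shift ht i
  cases s
  · refine ⟨_, _, near_extra_hub hr X, ?_, color_hub _ _ _ _⟩
    simp [color, shift]
  · refine ⟨_, _, (near_extra_hub hr X).symm, ?_, rfl⟩
    rw [color_hub, add_assoc, ← shift_not]
    rfl

theorem meet_eq_index {t : ℕ} (ht : 1 ≤ t) {X Y : Fin 3} (hXY : X ≠ Y) (i : ZMod (2 * t)) :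
    Meet t (some (X, i)) (some (Y, i)) := by
  obtain ⟨r, hr, s, rfl⟩ := exists_eq_add_shift ht i
  exact ⟨_, _, near_hub_hub hr hXY s, color_hub _ _ _ _, color_hub _ _ _ _⟩

theorem meet_add_of_ne {t : ℕ} (ht : 1 ≤ t) {X Y : Fin 3} (hXY : Y ≠ X) (j : ZMod (2 * t))
    {e : ℕ} (he : 1 ≤ e) (het : e ≤ t) : Meet t (some (X, j + e)) (some (Y, j)) := by
  obtain ⟨r, hr, s, rfl⟩ := exists_eq_add_shift ht j
  obtain ⟨k, hk, hko⟩ := exists_offset_eq (t := t) (o := t - e) (by omega)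
  refine ⟨_, _, near_path_hub hr hXY (!s) hk, ?_, by rw [Bool.not_not, color_hub]⟩
  rw [color, hko, shift_not, Nat.cast_sub het]
  congr 2
  ring

theorem meet_add_same {t : ℕ} (ht : 1 ≤ t) (X : Fin 3) (j : ZMod (2 * t)) {e : ℕ} (he : 1 ≤ e)
    (het : e < t) : Meet t (some (X, j + e)) (some (X, j)) := by
  obtain ⟨r, hr, s, hrs⟩ := exists_eq_add_shift ht (j + e + (((t - 1 - e) + 1) / 2 : ℕ))
  have hN := near_path_succ hr X s (k := t - 1 - e) (by omega)
  have hcolor : ∀ k l : ℕ, offset t k = l → ∀ i : ZMod (2 * t),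
      j + e + (((t - 1 - e) + 1) / 2 : ℕ) = i + l → color t (path r X s k) = some (X, i) := by
    intro k l hk i hi
    rw [color, hk, ← hrs, hi, add_sub_cancel_right]
  rcases Nat.mod_two_eq_zero_or_one (t - 1 - e) with h | h
  · refine ⟨_, _, hN, hcolor _ ((t - 1 - e + 1) / 2) ?_ _ rfl,
      hcolor _ (e + (t - 1 - e + 1) / 2) ?_ _ (by push_cast; ring)⟩
    · rw [offset, if_pos h]
      omega
    · rw [offset, if_neg (by omega)]
      omega
  · refine ⟨_, _, hN.symm, hcolor _ ((t - 1 - e + 1) / 2) ?_ _ rfl,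
      hcolor _ (e + (t - 1 - e + 1) / 2) ?_ _ (by push_cast; ring)⟩
    · rw [offset, if_pos (by omega)]
    · rw [offset, if_neg (by omega)]
      omega

theorem meet_of_ne {t : ℕ} (ht : 1 ≤ t) {c c' : Option (Fin 3 × ZMod (2 * t))} (h : c ≠ c') :
    Meet t c c' := by
  have : NeZero (2 * t) := ⟨by omega⟩
  obtain _ | ⟨X, i⟩ := c <;> obtain _ | ⟨Y, j⟩ := c'
  · exact absurd rfl h
  · exact meet_none ht Y j
  · exact (meet_none ht X i).symm
  obtain ⟨e, he, rfl⟩ : ∃ e < 2 * t, i = j + (e : ℕ) :=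
    ⟨(i - j).val, ZMod.val_lt _, by rw [ZMod.natCast_zmod_val]; ring⟩
  have hback : j = j + e + (2 * t - e : ℕ) := by
    rw [add_assoc, ← Nat.cast_add, Nat.add_sub_cancel' he.le, ZMod.natCast_self, add_zero]
  rcases Nat.eq_zero_or_pos e with rfl | he0
  · simp only [Nat.cast_zero, add_zero] at h ⊢
    exact meet_eq_index ht (fun hXY => h (by rw [hXY])) j
  by_cases hXY : X = Y
  · subst hXY
    rcases lt_trichotomy e t with het | rfl | het
    · exact meet_add_same ht X j he0 het
    · exact meet_antipodal ht X j
    · have := meet_add_same ht X (j + e) (e := 2 * t - e) (by omega) (by omega)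
      rw [← hback] at this
      exact this.symm
  · rcases le_or_gt e t with het | het
    · exact meet_add_of_ne ht (Ne.symm hXY) j he0 het
    · have := meet_add_of_ne ht hXY (j + e) (e := 2 * t - e) (by omega) (by omega)
      rw [← hback] at this
      exact this.symm

/-- The vertices that lie in triangles of the construction. -/
def vertex (t : ℕ) : Option (Fin t × (Fin 3 × Bool × Fin t ⊕ Fin 3)) → Node
  | none => apex
  | some (r, Sum.inl (X, s, k)) => path r X s k
  | some (r, Sum.inr X) => extra r X

theorem vertex_injective (t : ℕ) : Function.Injective (vertex t) := by
  rintro (_ | ⟨r, ⟨X, s, k⟩ | X⟩) (_ | ⟨r', ⟨X', s', k'⟩ | X'⟩) h <;>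
    simp_all [vertex, Fin.ext_iff]

theorem exists_facet_vertex_mem {t : ℕ} (ht : 1 ≤ t)
    (v : Option (Fin t × (Fin 3 × Bool × Fin t ⊕ Fin 3))) :
    ∃ τ ∈ facets t, vertex t v ∈ τ := by
  have key : ∀ {a b}, Near t a b → ∃ τ ∈ facets t, a ∈ τ := fun ⟨τ, hτ, ha, _⟩ => ⟨τ, hτ, ha⟩
  obtain _ | ⟨r, ⟨X, s, k⟩ | X⟩ := v
  · exact key (near_apex_hub (r := 0) ht 0)
  · exact key (near_path_hub (Y := X + 1) r.2 (by simp) s k.2)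
  · exact key (near_extra_hub r.2 X)

theorem exists_vertex_eq {t : ℕ} {τ : Finset Node} (hτ : τ ∈ facets t) {a : Node} (ha : a ∈ τ) :
    ∃ v, vertex t v = a := by
  obtain ⟨r, hr⟩ := Set.mem_iUnion.1 hτ
  have hpath : ∀ X s k, k < t → ∃ v, vertex t v = path r X s k := fun X s k hk =>
    ⟨some (r, Sum.inl (X, s, ⟨k, hk⟩)), rfl⟩
  have ht := r.2
  obtain ⟨X, rfl⟩ | ⟨X, s, rfl | ⟨Y, -, k, hk, rfl⟩⟩ := hr <;>
    simp only [Finset.mem_insert, Finset.mem_singleton] at ha <;>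
    obtain rfl | rfl | rfl := ha
  · exact ⟨none, rfl⟩
  · exact hpath _ _ _ (by omega)
  · exact ⟨some (r, Sum.inr X), rfl⟩
  all_goals exact hpath _ _ _ (by omega)

end Node

/-- For `t ≥ 1` and `n = 6t² + 3t + 1`, there exists a planar graph `G` of order `n`
with `ψ(G) = ψ_s(G) = ⌊√(6n − 47/4) + 1/2⌋ = 6t + 1`. -/
theorem exists_planar_achromatic_eq (t n : ℕ) (ht : 1 ≤ t)
    (hn : n = 6 * t ^ 2 + 3 * t + 1) :
    ∃ G : SimpleGraph (Fin n), G.IsPlanar ∧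
      G.achromatic = 6 * t + 1 ∧ G.pseudoachromatic = 6 * t + 1 ∧
      ⌊Real.sqrt (6 * n - 47 / 4) + 1 / 2⌋ = (6 * (t : ℤ) + 1) := by
  have : NeZero (2 * t) := ⟨by omega⟩
  have eV : Fin n ≃ Option (Fin t × (Fin 3 × Bool × Fin t ⊕ Fin 3)) := by
    refine Fintype.equivOfCardEq ?_
    simp [hn]
    ring
  have eC : Option (Fin 3 × ZMod (2 * t)) ≃ Fin (6 * t + 1) := by
    refine Fintype.equivOfCardEq ?_
    simp [ZMod.card]
    ring
  obtain ⟨G, hG, h1, h2⟩ := exists_le_achromatic_eq (k := 6 * t + 1) (by omega)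
    (fun v => eC (Node.color t (Node.vertex t (eV v))))
    (fun u v => Node.Near t (Node.vertex t (eV u)) (Node.vertex t (eV v)))
    (fun u v h => h.symm) (fun i j hij => by
      obtain ⟨a, b, ⟨τ, hτ, ha, hb⟩, hac, hbc⟩ := Node.meet_of_ne ht (eC.symm.injective.ne hij)
      obtain ⟨u, rfl⟩ := Node.exists_vertex_eq hτ ha
      obtain ⟨v, rfl⟩ := Node.exists_vertex_eq hτ hb
      refine ⟨eV.symm u, eV.symm v, ?_, ?_, ?_⟩
      · simpa using ⟨τ, hτ, ha, hb⟩
      · simp [hac]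
      · simp [hbc])
  refine ⟨G, (Node.realizable_facets t).isPlanar ((Node.vertex_injective t).comp eV.injective)
    (fun v => Node.exists_facet_vertex_mem ht _) hG, h1, h2, ?_⟩
  have ht' : (1 : ℝ) ≤ t := by exact_mod_cast ht
  have hlow : 6 * (t : ℝ) + 1 / 2 ≤ Real.sqrt (6 * n - 47 / 4) := by
    refine Real.le_sqrt_of_sq_le ?_
    rw [hn]
    push_cast
    nlinarith
  have hup : Real.sqrt (6 * n - 47 / 4) < 6 * (t : ℝ) + 3 / 2 := by
    rw [Real.sqrt_lt' (by positivity), hn]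
    push_cast
    nlinarith
  rw [Int.floor_eq_iff]
  push_cast
  constructor <;> linarith
end

section
/- For every integer n ≥ 10 there exists a planar graph H of order n with ψ(H) ≥ ⌊√(6n − 47/4) − 9/2⌋. -/
open SimpleGraph

open Set in
/-- A graph whose edges are among the pairs related by `R`, drawn with straight segments whose
interiors contain no vertex and are pairwise disjoint, is planar. -/
theorem SimpleGraph.isPlanar_of_openSegment {V : Type*} {G : SimpleGraph V} {R : V → V → Prop}
    (f : V → ℝ × ℝ) (hf : Function.Injective f) (hG : ∀ u v, G.Adj u v → R u v ∨ R v u)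
    (hvert : ∀ u v w, R u v → f w ∉ openSegment ℝ (f u) (f v))
    (hedge : ∀ u v u' v', R u v → R u' v' → ∀ P ∈ openSegment ℝ (f u) (f v),
      P ∈ openSegment ℝ (f u') (f v') → u = u' ∧ v = v') : G.IsPlanar := by
  have hmem : ∀ (u v : V) (t : unitInterval), t ≠ 0 → t ≠ 1 →
      Path.segment (f u) (f v) t ∈ openSegment ℝ (f u) (f v) := by
    intro u v t h0 h1
    rw [openSegment_eq_image_lineMap]
    exact ⟨t, ⟨unitInterval.pos_iff_ne_zero.2 h0, unitInterval.lt_one_iff_ne_one.2 h1⟩, rfl⟩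
  have hvert' : ∀ u v w, G.Adj u v → f w ∉ openSegment ℝ (f u) (f v) := by
    intro u v w h
    rcases hG u v h with h | h
    · exact hvert u v w h
    · rw [openSegment_symm]
      exact hvert v u w h
  have hedge' : ∀ u v u' v', G.Adj u v → G.Adj u' v' → ∀ P ∈ openSegment ℝ (f u) (f v),
      P ∈ openSegment ℝ (f u') (f v') → s(u, v) = s(u', v') := by
    intro u v u' v' h h' P hP hP'
    rw [Sym2.eq_iff]
    rcases hG u v h with h | h <;> rcases hG u' v' h' with h' | h'
    · exact Or.inl (hedge _ _ _ _ h h' P hP hP')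
    · rw [openSegment_symm] at hP'
      exact Or.inr (hedge _ _ _ _ h h' P hP hP')
    · rw [openSegment_symm] at hP
      exact Or.inr (hedge _ _ _ _ h h' P hP hP').symm
    · rw [openSegment_symm] at hP hP'
      exact Or.inl (hedge _ _ _ _ h h' P hP hP').symm
  refine ⟨f, hf, fun u v _ => Path.segment (f u) (f v), ?_, ?_, ?_⟩
  · exact fun u v h => Path.segment_injective_of_ne fun e => h.ne (hf e)
  · exact fun u v h t h0 h1 w e => hvert' u v w h (e ▸ hmem u v t h0 h1)
  · intro u v u' v' h h' hne s t h0 h1 e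
    have hs := hmem u v s h0 h1
    by_cases ht0 : t = 0
    · subst ht0
      rw [e, Path.source] at hs
      exact hvert' u v u' h hs
    by_cases ht1 : t = 1
    · subst ht1
      rw [e, Path.target] at hs
      exact hvert' u v v' h hs
    · exact hne (hedge' u v u' v' h h' _ hs (e ▸ hmem u' v' t ht0 ht1))

theorem SimpleGraph.IsPlanar.comap {V W : Type*} {G : SimpleGraph W} (hG : G.IsPlanar)
    {e : V → W} (he : Function.Injective e) : (G.comap e).IsPlanar := by
  obtain ⟨f, hf, γ, h1, h2, h3⟩ := hG
  refine ⟨f ∘ e, hf.comp he, fun u v h => γ (show G.Adj (e u) (e v) from h), ?_, ?_, ?_⟩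
  · exact fun u v h => h1 _
  · exact fun u v h t h0 h1' w => h2 _ t h0 h1' (e w)
  · intro u v u' v' h h' hne
    refine h3 _ _ fun e' => hne ?_
    exact Sym2.map.injective he (by simpa using e')

/-- A proper complete coloring with colors in `C` bounds the achromatic number from below. -/
theorem SimpleGraph.card_le_achromatic {V C : Type*} [Finite V] [Fintype C] [Nontrivial C]
    {G : SimpleGraph V} (c : V → C) (hproper : ∀ u v, G.Adj u v → c u ≠ c v)
    (hcomplete : ∀ a b, a ≠ b → ∃ u v, G.Adj u v ∧ c u = a ∧ c v = b) :
    Fintype.card C ≤ G.achromatic := by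
  let φ := Fintype.equivFin C
  apply le_csSup
  · refine ⟨Nat.card V, ?_⟩
    rintro k ⟨d, -, hd, -⟩
    simpa using Nat.card_le_card_of_surjective d hd
  · refine ⟨φ ∘ c, fun u v h e => hproper u v h (φ.injective e), ?_, ?_⟩
    · intro i
      obtain ⟨b, hb⟩ := exists_ne (φ.symm i)
      obtain ⟨u, -, -, hu, -⟩ := hcomplete _ _ hb.symm
      exact ⟨u, by simp [hu]⟩
    · intro i j hij
      obtain ⟨u, v, h, hu, hv⟩ := hcomplete (φ.symm i) (φ.symm j) (by simpa using hij)
      exact ⟨u, v, h, by simp [hu], by simp [hv]⟩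

namespace SuspendedColumns

/-- Vertices of an infinite planar graph: apexes alternate with columns of height `p`; the tops of
the columns are joined to `top`, the bottoms to `bot`, and `top` to the pendant vertex `pend`. -/
inductive Vertex (p : ℕ) : Type
  | apex (j : ℕ) : Vertex p
  | col (j : ℕ) (i : Fin p) : Vertex p
  | top : Vertex p
  | bot : Vertex p
  | pend : Vertex p

/-- Oriented edges of the graph. -/
inductive Edge (p : ℕ) : Vertex p → Vertex p → Prop
  | left (j : ℕ) (i : Fin p) : Edge p (.apex j) (.col j i)
  | right (j : ℕ) (i : Fin p) : Edge p (.apex (j + 1)) (.col j i)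
  | up (j : ℕ) (i i' : Fin p) (h : (i : ℕ) + 1 = i') : Edge p (.col j i) (.col j i')
  | top (j : ℕ) (i : Fin p) (h : (i : ℕ) + 1 = p) : Edge p .top (.col j i)
  | bot (j : ℕ) (i : Fin p) (h : (i : ℕ) = 0) : Edge p .bot (.col j i)
  | pend : Edge p .top .pend

/-- Positions of the vertices. -/
def intPos {p : ℕ} : Vertex p → ℤ × ℤ
  | .apex j => (2 * j, 0)
  | .col j i => (2 * j + 1, (i : ℕ))
  | .top => (-2, p)
  | .bot => (-2, -1)
  | .pend => (-2, p + 1)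

/-- Positions of the vertices in the real plane. -/
def pos {p : ℕ} (v : Vertex p) : ℝ × ℝ := ((intPos v).1, (intPos v).2)

theorem pos_injective {p : ℕ} : Function.Injective (pos (p := p)) := by
  intro u v h
  simp only [pos, Prod.mk.injEq, Int.cast_inj] at h
  cases u <;> cases v <;> simp only [intPos] at h <;>
    simp only [Vertex.apex.injEq, Vertex.col.injEq, Fin.ext_iff, reduceCtorEq] <;> omega

theorem exists_of_mem_openSegment {a b c d : ℝ} {P : ℝ × ℝ}
    (h : P ∈ openSegment ℝ (a, b) (c, d)) :
    ∃ t, 0 < t ∧ t < 1 ∧ P.1 = a + t * (c - a) ∧ P.2 = b + t * (d - b) := by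
  rw [openSegment_eq_image'] at h
  obtain ⟨t, ⟨h0, h1⟩, rfl⟩ := h
  exact ⟨t, h0, h1, by simp, by simp⟩

theorem not_intCast_of_mem_Ioo {a b : ℤ} (h1 : (b : ℝ) < a) (h2 : (a : ℝ) < b + 1) : False := by
  have h1' : b < a := by exact_mod_cast h1
  have h2' : a < b + 1 := by exact_mod_cast h2
  omega

theorem pos_notMem_openSegment {p : ℕ} (u v w : Vertex p) (h : Edge p u v) :
    pos w ∉ openSegment ℝ (pos u) (pos v) := by
  intro hw
  obtain ⟨t, h0, h1, hx, hy⟩ := exists_of_mem_openSegment hw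
  simp only [pos] at hx hy
  generalize intPos w = q at hx hy
  cases h with
  | left j i =>
    simp only [intPos] at hx
    apply not_intCast_of_mem_Ioo (a := q.1) (b := 2 * j) <;> push_cast at * <;> linarith
  | right j i =>
    simp only [intPos] at hx
    apply not_intCast_of_mem_Ioo (a := q.1) (b := 2 * j + 1) <;> push_cast at * <;>
      linarith
  | up j i i' h =>
    simp only [intPos, ← h] at hy
    apply not_intCast_of_mem_Ioo (a := q.2) (b := (i : ℕ)) <;> push_cast at * <;> linarith
  | top j i h =>
    have h' : (((i : ℕ) : ℝ)) + 1 = p := by exact_mod_cast h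
    simp only [intPos, ← h] at hy
    apply not_intCast_of_mem_Ioo (a := q.2) (b := (i : ℕ)) <;> push_cast at * <;> linarith
  | bot j i h =>
    simp only [intPos, h] at hy
    apply not_intCast_of_mem_Ioo (a := q.2) (b := -1) <;> push_cast at * <;> linarith
  | pend =>
    simp only [intPos] at hy
    apply not_intCast_of_mem_Ioo (a := q.2) (b := p) <;> push_cast at * <;> linarith

/-- The points on the open edges, in coordinates. -/
theorem Edge.exists_coord {p : ℕ} {u v : Vertex p} (h : Edge p u v) {P : ℝ × ℝ}
    (hP : P ∈ openSegment ℝ (pos u) (pos v)) : ∃ t : ℝ, 0 < t ∧ t < 1 ∧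
      ((∃ (j : ℕ) (i : Fin p), u = .apex j ∧ v = .col j i ∧
          P.1 = 2 * j + t ∧ P.2 = t * (i : ℕ)) ∨
        (∃ (j : ℕ) (i : Fin p), u = .apex (j + 1) ∧ v = .col j i ∧
          P.1 = 2 * j + 2 - t ∧ P.2 = t * (i : ℕ)) ∨
        (∃ (j : ℕ) (i i' : Fin p), u = .col j i ∧ v = .col j i' ∧ (i : ℕ) + 1 = i' ∧
          P.1 = 2 * j + 1 ∧ P.2 = (i : ℕ) + t) ∨
        (∃ (j : ℕ) (i : Fin p), u = .top ∧ v = .col j i ∧ (i : ℕ) + 1 = p ∧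
          P.1 = -2 + t * (2 * j + 3) ∧ P.2 = p - t) ∨
        (∃ (j : ℕ) (i : Fin p), u = .bot ∧ v = .col j i ∧ (i : ℕ) = 0 ∧
          P.1 = -2 + t * (2 * j + 3) ∧ P.2 = -1 + t) ∨
        (u = .top ∧ v = .pend ∧ P.2 = p + t)) := by
  obtain ⟨t, h0, h1, hx, hy⟩ := exists_of_mem_openSegment hP
  refine ⟨t, h0, h1, ?_⟩
  cases h with
  | left j i =>
    refine Or.inl ⟨j, i, rfl, rfl, ?_, ?_⟩
    · rw [hx]; simp [intPos]
    · rw [hy]; simp [intPos]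
  | right j i =>
    refine Or.inr (Or.inl ⟨j, i, rfl, rfl, ?_, ?_⟩)
    · rw [hx]; simp [intPos]; ring
    · rw [hy]; simp [intPos]
  | up j i i' h =>
    refine Or.inr (Or.inr (Or.inl ⟨j, i, i', rfl, rfl, h, ?_, ?_⟩))
    · rw [hx]; simp [intPos]
    · rw [hy]; simp [intPos, ← h]
  | top j i h =>
    have h' : (((i : ℕ) : ℝ)) = p - 1 := by
      rw [eq_sub_iff_add_eq]
      exact_mod_cast h
    refine Or.inr (Or.inr (Or.inr (Or.inl ⟨j, i, rfl, rfl, h, ?_, ?_⟩)))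
    · rw [hx]; simp only [intPos]; push_cast; ring
    · rw [hy]; simp [intPos, h']; ring
  | bot j i h =>
    refine Or.inr (Or.inr (Or.inr (Or.inr (Or.inl ⟨j, i, rfl, rfl, h, ?_, ?_⟩))))
    · rw [hx]; simp only [intPos]; push_cast; ring
    · rw [hy]; simp [intPos, h]
  | pend =>
    refine Or.inr (Or.inr (Or.inr (Or.inr (Or.inr ⟨rfl, rfl, ?_⟩))))
    rw [hy]; simp [intPos]

theorem mul_fin_mem {p : ℕ} (i : Fin p) {t : ℝ} (h0 : 0 < t) (h1 : t < 1) :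
    0 ≤ t * (i : ℕ) ∧ t * (i : ℕ) ≤ p - 1 ∧ ((i : ℕ) : ℝ) + 1 ≤ p := by
  have h2 : (0 : ℝ) ≤ (i : ℕ) := by positivity
  have h3 : ((i : ℕ) : ℝ) + 1 ≤ p := by exact_mod_cast i.2
  exact ⟨by positivity, by nlinarith, h3⟩

theorem nat_eq_of_abs_lt {a b : ℕ} (h1 : (a : ℝ) < b + 1) (h2 : (b : ℝ) < a + 1) : a = b := by
  have h1' : a < b + 1 := by exact_mod_cast h1
  have h2' : b < a + 1 := by exact_mod_cast h2
  omega

theorem Edge.eq_of_mem_openSegment {p : ℕ} (u v u' v' : Vertex p) (h : Edge p u v)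
    (h' : Edge p u' v') (P : ℝ × ℝ) (hP : P ∈ openSegment ℝ (pos u) (pos v))
    (hP' : P ∈ openSegment ℝ (pos u') (pos v')) : u = u' ∧ v = v' := by
  obtain ⟨t, t0, t1, H⟩ := h.exists_coord hP
  obtain ⟨s, s0, s1, H'⟩ := h'.exists_coord hP'
  clear h h' hP hP'
  rcases H with ⟨j, i, rfl, rfl, hx, hy⟩ | ⟨j, i, rfl, rfl, hx, hy⟩ |
      ⟨j, i, i₁, rfl, rfl, hi, hx, hy⟩ | ⟨j, i, rfl, rfl, hi, hx, hy⟩ |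
      ⟨j, i, rfl, rfl, hi, hx, hy⟩ | ⟨rfl, rfl, hy⟩ <;>
    rcases H' with ⟨j', i', rfl, rfl, hx', hy'⟩ | ⟨j', i', rfl, rfl, hx', hy'⟩ |
      ⟨j', i', i₁', rfl, rfl, hi', hx', hy'⟩ | ⟨j', i', rfl, rfl, hi', hx', hy'⟩ |
      ⟨j', i', rfl, rfl, hi', hx', hy'⟩ | ⟨rfl, rfl, hy'⟩
  all_goals try have hb := mul_fin_mem i t0 t1
  all_goals try have hb' := mul_fin_mem i' s0 s1
  all_goals try have hc := mul_fin_mem i₁ t0 t1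
  all_goals try have hc' := mul_fin_mem i₁' s0 s1
  all_goals try have hi_cast : ((i : ℕ) : ℝ) + 1 = (i₁ : ℕ) := by exact_mod_cast hi
  all_goals try have hi_cast' : ((i' : ℕ) : ℝ) + 1 = (i₁' : ℕ) := by exact_mod_cast hi'
  all_goals try have hi_pos : (0 : ℝ) ≤ (i : ℕ) := Nat.cast_nonneg _
  all_goals try have hi_pos' : (0 : ℝ) ≤ (i' : ℕ) := Nat.cast_nonneg _
  all_goals try have hp : (0 : ℝ) ≤ p := Nat.cast_nonneg _
  all_goals try (exfalso; linarith)
  all_goals try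
    exfalso
    rcases Nat.lt_or_ge j j' with hj | hj
    · have : (j : ℝ) + 1 ≤ j' := by exact_mod_cast hj
      linarith
    · rcases hj.eq_or_lt with rfl | hj
      · linarith
      · have : (j' : ℝ) + 1 ≤ j := by exact_mod_cast hj
        linarith
  · obtain rfl : j = j' := nat_eq_of_abs_lt (by linarith) (by linarith)
    obtain rfl : t = s := by linarith
    have : ((i : ℕ) : ℝ) = (i' : ℕ) := mul_left_cancel₀ t0.ne' (hy.symm.trans hy')
    obtain rfl : i = i' := Fin.ext (by exact_mod_cast this)
    exact ⟨rfl, rfl⟩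
  · obtain rfl : j = j' := nat_eq_of_abs_lt (by linarith) (by linarith)
    obtain rfl : t = s := by linarith
    have : ((i : ℕ) : ℝ) = (i' : ℕ) := mul_left_cancel₀ t0.ne' (hy.symm.trans hy')
    obtain rfl : i = i' := Fin.ext (by exact_mod_cast this)
    exact ⟨rfl, rfl⟩
  · obtain rfl : j = j' := nat_eq_of_abs_lt (by linarith) (by linarith)
    obtain rfl : i = i' := Fin.ext (nat_eq_of_abs_lt (by linarith) (by linarith))
    obtain rfl : i₁ = i₁' := Fin.ext (by omega)
    exact ⟨rfl, rfl⟩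
  · obtain rfl : t = s := by linarith
    have h3 : (2 * j + 3 : ℝ) = 2 * j' + 3 := mul_left_cancel₀ t0.ne' (by linarith)
    obtain rfl : j = j' := nat_eq_of_abs_lt (by linarith) (by linarith)
    obtain rfl : i = i' := Fin.ext (by omega)
    exact ⟨rfl, rfl⟩
  · obtain rfl : t = s := by linarith
    have h3 : (2 * j + 3 : ℝ) = 2 * j' + 3 := mul_left_cancel₀ t0.ne' (by linarith)
    obtain rfl : j = j' := nat_eq_of_abs_lt (by linarith) (by linarith)
    obtain rfl : i = i' := Fin.ext (by omega)
    exact ⟨rfl, rfl⟩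
  · exact ⟨rfl, rfl⟩

/-- The subgraph of the drawn graph consisting of the edges properly colored by `c`. -/
def graph {p : ℕ} {C : Type*} (c : Vertex p → C) : SimpleGraph (Vertex p) where
  Adj u v := (Edge p u v ∨ Edge p v u) ∧ c u ≠ c v
  symm := ⟨fun _ _ h => ⟨h.1.symm, h.2.symm⟩⟩
  loopless := ⟨fun _ h => h.2 rfl⟩

theorem graph_isPlanar {p : ℕ} {C : Type*} (c : Vertex p → C) : (graph c).IsPlanar :=
  SimpleGraph.isPlanar_of_openSegment pos pos_injective (fun _ _ h => h.1)
    pos_notMem_openSegment Edge.eq_of_mem_openSegment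

/-- A zigzag enumeration of the integers in `[p, 2p)`. -/
def zigzag (p i : ℕ) : ℤ := if i % 2 = 0 then p + i / 2 else 2 * p - 1 - i / 2

theorem exists_zigzag_eq {p : ℕ} {e : ℤ} (h1 : p ≤ e) (h2 : e < 2 * p) :
    ∃ i : Fin p, zigzag p i = e := by
  by_cases h : 2 * (e - p) < p
  · refine ⟨⟨(2 * (e - p)).toNat, by omega⟩, ?_⟩
    simp only [zigzag]
    split_ifs <;> omega
  · refine ⟨⟨(2 * (2 * p - 1 - e) + 1).toNat, by omega⟩, ?_⟩
    simp only [zigzag]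
    split_ifs <;> omega

theorem exists_zigzag_sub_eq {p : ℕ} {d : ℤ} (h1 : 1 ≤ d) (h2 : d < p) :
    ∃ i i' : Fin p, (i : ℕ) + 1 = i' ∧
      (zigzag p i' - zigzag p i = d ∨ zigzag p i' - zigzag p i = -d) := by
  refine ⟨⟨(p - 1 - d).toNat, by omega⟩, ⟨(p - 1 - d).toNat + 1, by omega⟩, rfl, ?_⟩
  simp only [zigzag]
  split_ifs <;> omega

/-- The coloring of the vertices by `ZMod N` and two extra colors. -/
def color (p N : ℕ) (τ : ℤ) : Vertex p → Option (Option (ZMod N))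
  | .apex j => some (some j)
  | .col j i => some (some (j + τ * zigzag p i))
  | .top => none
  | .bot => some none
  | .pend => some none

open Classical in
/-- The vertices that suffice to make all pairs of colors adjacent. -/
noncomputable def core (p N : ℕ) : Finset (Vertex p) :=
  ((Finset.range (N + 1)).image .apex ∪
    (Finset.range N ×ˢ Finset.univ).image fun x => .col x.1 x.2) ∪ {.top, .bot, .pend}

open Classical in
theorem card_core_le (p N : ℕ) : (core p N).card ≤ N * (p + 1) + 4 := by
  refine (Finset.card_union_le _ _).trans <| (Nat.add_le_add ((Finset.card_union_le _ _).trans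
    (Nat.add_le_add Finset.card_image_le Finset.card_image_le)) Finset.card_le_three).trans ?_
  simp only [Finset.card_range, Finset.card_product, Finset.card_univ, Fintype.card_fin]
  exact le_of_eq (by ring)

theorem apex_mem_core {p N j : ℕ} (h : j ≤ N) : Vertex.apex j ∈ core p N := by
  simpa [core] using h

theorem col_mem_core {p N j : ℕ} (h : j < N) (i : Fin p) : Vertex.col j i ∈ core p N := by
  simp [core, h]

/-- Two colors are joined by an edge between core vertices. -/
def Joined (p N : ℕ) (τ : ℤ) (a b : Option (Option (ZMod N))) : Prop :=
  ∃ u ∈ core p N, ∃ v ∈ core p N, (Edge p u v ∨ Edge p v u) ∧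
    color p N τ u = a ∧ color p N τ v = b

theorem Joined.symm {p N : ℕ} {τ : ℤ} {a b : Option (Option (ZMod N))} (h : Joined p N τ a b) :
    Joined p N τ b a := by
  obtain ⟨u, hu, v, hv, h, ha, hb⟩ := h
  exact ⟨v, hv, u, hu, h.symm, hb, ha⟩

theorem joined_of_sub_eq {p N : ℕ} [NeZero N] {τ B d : ℤ} (hτ : (τ : ZMod N) * B = -1)
    (hB : ∀ d : ℤ, 2 * p ≤ d → 2 * d < N → p ≤ N - d - B ∧ N - d - B < 2 * p)
    {x y : ZMod N} (hd : y - x = τ * d) (h1 : 1 ≤ d) (h2 : 2 * d < N) :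
    Joined p N τ (some (some x)) (some (some y)) := by
  obtain rfl : y = x + τ * d := by rw [← hd]; ring
  rcases lt_or_ge d p with h3 | h3
  · obtain ⟨i, i', hi, h⟩ := exists_zigzag_sub_eq h1 h3
    rcases h with h | h
    · refine ⟨.col (x - τ * zigzag p i).val i, col_mem_core (ZMod.val_lt _) _,
        .col (x - τ * zigzag p i).val i', col_mem_core (ZMod.val_lt _) _, Or.inl (.up _ _ _ hi),
        ?_, ?_⟩
      · simp [color]
      · rw [← h]
        simp only [color, ZMod.natCast_val, ZMod.cast_id', id_eq]
        push_cast
        congr 2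
        ring
    · refine ⟨.col (x - τ * zigzag p i').val i', col_mem_core (ZMod.val_lt _) _,
        .col (x - τ * zigzag p i').val i, col_mem_core (ZMod.val_lt _) _, Or.inr (.up _ _ _ hi),
        ?_, ?_⟩
      · simp [color]
      · rw [← neg_neg d, ← h]
        simp only [color, ZMod.natCast_val, ZMod.cast_id', id_eq]
        push_cast
        congr 2
        ring
  rcases lt_or_ge d (2 * p) with h4 | h4
  · obtain ⟨i, hi⟩ := exists_zigzag_eq h3 h4
    exact ⟨.apex x.val, apex_mem_core (ZMod.val_lt _).le, .col x.val i,
      col_mem_core (ZMod.val_lt _) _, Or.inl (.left _ _), by simp [color], by simp [color, hi]⟩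
  · obtain ⟨i, hi⟩ := exists_zigzag_eq (hB d h4 h2).1 (hB d h4 h2).2
    refine ⟨.col (x + τ * d - 1).val i, col_mem_core (ZMod.val_lt _) _,
      .apex ((x + τ * d - 1).val + 1), apex_mem_core (ZMod.val_lt _), Or.inr (.right _ _), ?_, ?_⟩
    · simp only [color, hi, ZMod.natCast_val, ZMod.cast_id', id_eq]
      push_cast
      simp only [CharP.cast_eq_zero]
      congr 2
      linear_combination -hτ
    · simp [color]

theorem joined_zmod {p N : ℕ} [NeZero N] {τ B : ℤ} (hN : N % 2 = 1)
    (hτ : (τ : ZMod N) * B = -1)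
    (hB : ∀ d : ℤ, 2 * p ≤ d → 2 * d < N → p ≤ N - d - B ∧ N - d - B < 2 * p)
    {x y : ZMod N} (hxy : x ≠ y) : Joined p N τ (some (some x)) (some (some y)) := by
  have hd : y - x = τ * ((-B * (y - x) : ZMod N).valMinAbs : ℤ) := by
    rw [ZMod.coe_valMinAbs]
    linear_combination (y - x) * hτ
  have hmem := ZMod.valMinAbs_mem_Ioc (-B * (y - x) : ZMod N)
  generalize (-B * (y - x) : ZMod N).valMinAbs = d at hd hmem
  obtain ⟨h1, h2⟩ := hmem
  rcases lt_trichotomy d 0 with h | rfl | h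
  · refine (joined_of_sub_eq (d := -d) hτ hB ?_ (by omega) (by omega)).symm
    push_cast
    linear_combination -hd
  · exact absurd (sub_eq_zero.1 (by simpa using hd)).symm hxy
  · exact joined_of_sub_eq hτ hB hd (by omega) (by omega)

theorem joined_top {p N : ℕ} [NeZero N] (hp : 0 < p) (τ : ℤ) (x : ZMod N) :
    Joined p N τ none (some (some x)) := by
  let i : Fin p := ⟨p - 1, by omega⟩
  exact ⟨.top, by simp [core], .col (x - τ * zigzag p i).val i, col_mem_core (ZMod.val_lt _) _,
    Or.inl (.top _ _ (by simp only [i]; omega)), rfl, by simp [color]⟩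

theorem joined_bot {p N : ℕ} [NeZero N] (hp : 0 < p) (τ : ℤ) (x : ZMod N) :
    Joined p N τ (some none) (some (some x)) := by
  let i : Fin p := ⟨0, hp⟩
  exact ⟨.bot, by simp [core], .col (x - τ * zigzag p i).val i, col_mem_core (ZMod.val_lt _) _,
    Or.inl (.bot _ _ rfl), rfl, by simp [color]⟩

theorem joined_top_bot (p N : ℕ) (τ : ℤ) : Joined p N τ none (some none) :=
  ⟨.top, by simp [core], .pend, by simp [core], Or.inl .pend, rfl, rfl⟩

theorem joined_of_ne {p N : ℕ} [NeZero N] {τ B : ℤ} (hp : 0 < p) (hN : N % 2 = 1)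
    (hτ : (τ : ZMod N) * B = -1)
    (hB : ∀ d : ℤ, 2 * p ≤ d → 2 * d < N → p ≤ N - d - B ∧ N - d - B < 2 * p) :
    ∀ a b : Option (Option (ZMod N)), a ≠ b → Joined p N τ a b
  | none, none, h => absurd rfl h
  | some none, some none, h => absurd rfl h
  | none, some none, _ => joined_top_bot p N τ
  | some none, none, _ => (joined_top_bot p N τ).symm
  | none, some (some x), _ => joined_top hp τ x
  | some (some x), none, _ => (joined_top hp τ x).symm
  | some none, some (some x), _ => joined_bot hp τ x
  | some (some x), some none, _ => (joined_bot hp τ x).symm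
  | some (some _), some (some _), h => joined_zmod hN hτ hB fun e => h (by rw [e])

instance (p : ℕ) : Infinite (Vertex p) :=
  Infinite.of_injective Vertex.apex fun _ _ h => Vertex.apex.inj h

theorem exists_planar {n p N : ℕ} {τ B : ℤ} (hp : 0 < p) (hN : N % 2 = 1)
    (hτ : (τ : ZMod N) * B = -1)
    (hB : ∀ d : ℤ, 2 * p ≤ d → 2 * d < N → p ≤ N - d - B ∧ N - d - B < 2 * p)
    (hn : N * (p + 1) + 4 ≤ n) :
    ∃ H : SimpleGraph (Fin n), H.IsPlanar ∧ N + 2 ≤ H.achromatic := by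
  have : NeZero N := ⟨by omega⟩
  obtain ⟨t, hsub, hcard⟩ :=
    Infinite.exists_superset_card_eq (core p N) n ((card_core_le p N).trans hn)
  let e := t.equivFinOfCardEq hcard
  refine ⟨(graph (color p N τ)).comap fun k => (e.symm k : Vertex p),
    (graph_isPlanar _).comap (Subtype.val_injective.comp e.symm.injective), ?_⟩
  have hC : Fintype.card (Option (Option (ZMod N))) = N + 2 := by simp [ZMod.card]
  rw [← hC]
  refine SimpleGraph.card_le_achromatic (fun k => color p N τ (e.symm k)) (fun u v h => h.2) ?_
  intro a b hab
  obtain ⟨u, hu, v, hv, h, rfl, rfl⟩ := joined_of_ne hp hN hτ hB a b hab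
  exact ⟨e ⟨u, hsub hu⟩, e ⟨v, hsub hv⟩, by simpa [graph] using ⟨h, hab⟩, by simp, by simp⟩

theorem exists_planar_of_eq_six_mul_sub_one {n p : ℕ} (hp : 0 < p)
    (hn : (6 * p - 1) * (p + 1) + 4 ≤ n) :
    ∃ H : SimpleGraph (Fin n), H.IsPlanar ∧ 6 * p + 1 ≤ H.achromatic := by
  have h : (((6 * p - 1 : ℕ) : ℤ) : ZMod (6 * p - 1)) = 0 := by
    rw [Int.cast_natCast, ZMod.natCast_self]
  rw [show ((6 * p - 1 : ℕ) : ℤ) = 6 * p - 1 by omega] at h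
  have := exists_planar (N := 6 * p - 1) (τ := -3) (B := 2 * p) hp (by omega)
    (by push_cast at h ⊢; linear_combination -h) (by omega) hn
  rwa [show 6 * p - 1 + 2 = 6 * p + 1 by omega] at this

theorem exists_planar_of_eq_six_mul_sub_five {n p : ℕ} (hp : 0 < p)
    (hn : (6 * p - 5) * (p + 1) + 4 ≤ n) :
    ∃ H : SimpleGraph (Fin n), H.IsPlanar ∧ 6 * p - 3 ≤ H.achromatic := by
  have h : (((6 * p - 5 : ℕ) : ℤ) : ZMod (6 * p - 5)) = 0 := by
    rw [Int.cast_natCast, ZMod.natCast_self]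
  rw [show ((6 * p - 5 : ℕ) : ℤ) = 6 * p - 5 by omega] at h
  have := exists_planar (N := 6 * p - 5) (τ := 3) (B := 2 * p - 2) hp (by omega)
    (by push_cast at h ⊢; linear_combination h) (by omega) hn
  rwa [show 6 * p - 5 + 2 = 6 * p - 3 by omega] at this

theorem exists_planar_of_sq_le {n k : ℕ} (hk : 2 ≤ k) (h : k ^ 2 + 9 * k + 32 ≤ 6 * n) :
    ∃ H : SimpleGraph (Fin n), H.IsPlanar ∧ k ≤ H.achromatic := by
  obtain ⟨q, r, hr, rfl⟩ : ∃ q r, r < 6 ∧ k = 6 * q + 2 + r :=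
    ⟨(k - 2) / 6, (k - 2) % 6, by omega, by omega⟩
  by_cases hr2 : r < 2
  · obtain ⟨H, hH, hle⟩ := exists_planar_of_eq_six_mul_sub_five (n := n) (p := q + 1) (by omega) (by
      rw [show 6 * (q + 1) - 5 = 6 * q + 1 by omega]
      interval_cases r <;> nlinarith)
    exact ⟨H, hH, by omega⟩
  · obtain ⟨H, hH, hle⟩ := exists_planar_of_eq_six_mul_sub_one (n := n) (p := q + 1) (by omega) (by
      rw [show 6 * (q + 1) - 1 = 6 * q + 5 by omega]
      interval_cases r <;> first | omega | nlinarith)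
    exact ⟨H, hH, by omega⟩

end SuspendedColumns

/-- For every `n ≥ 10` there exists a planar graph `H` of order `n` with
`ψ(H) ≥ ⌊√(6n − 47/4) − 9/2⌋`. -/
theorem exists_planar_achromatic_ge (n : ℕ) (hn : 10 ≤ n) :
    ∃ H : SimpleGraph (Fin n), H.IsPlanar ∧
      ⌊Real.sqrt (6 * n - 47 / 4) - 9 / 2⌋ ≤ (H.achromatic : ℤ) := by
  have hn' : (10 : ℝ) ≤ n := by exact_mod_cast hn
  have hsqrt : 0 ≤ Real.sqrt (6 * n - 47 / 4) := Real.sqrt_nonneg _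
  have hsq : Real.sqrt (6 * n - 47 / 4) ^ 2 = 6 * n - 47 / 4 := Real.sq_sqrt (by linarith)
  have h2 : 2 ≤ ⌊Real.sqrt (6 * n - 47 / 4) - 9 / 2⌋ := by
    rw [Int.le_floor]
    push_cast
    nlinarith
  obtain ⟨k, hk⟩ := Int.eq_ofNat_of_zero_le (le_trans (by norm_num) h2)
  have hle := Int.floor_le (Real.sqrt (6 * n - 47 / 4) - 9 / 2)
  rw [hk] at h2 hle ⊢
  push_cast at hle
  have hk0 : (0 : ℝ) ≤ k := k.cast_nonneg
  have h : (k : ℝ) ^ 2 + 9 * k + 32 ≤ 6 * n := by nlinarith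
  obtain ⟨H, hH, hkH⟩ := SuspendedColumns.exists_planar_of_sq_le (n := n) (k := k)
    (by exact_mod_cast h2) (by exact_mod_cast h)
  exact ⟨H, hH, by exact_mod_cast hkH⟩
end

section
/- For every integer n ≥ 5 there exists an outerplanar graph H of order n with ψ(H) ≥ ⌊√(4n − 23/4) − 5/2⌋. -/
open SimpleGraph

theorem SimpleGraph.isPlanar_of_segments {V : Type*} (G : SimpleGraph V) (f : V → ℝ × ℝ)
    (hf : Function.Injective f)
    (hvertex : ∀ ⦃u v : V⦄, G.Adj u v → ∀ t : ℝ, 0 < t → t < 1 → ∀ w,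
      AffineMap.lineMap (f u) (f v) t ≠ f w)
    (hedge : ∀ ⦃u v u' v' : V⦄, G.Adj u v → G.Adj u' v' → s(u, v) ≠ s(u', v') →
      ∀ s t : ℝ, 0 < s → s < 1 → 0 < t → t < 1 →
        (AffineMap.lineMap (f u) (f v) s : ℝ × ℝ) ≠ AffineMap.lineMap (f u') (f v') t) :
    G.IsPlanar := by
  have hpos : ∀ t : unitInterval, t ≠ 0 → (0 : ℝ) < t := fun t ht =>
    lt_of_le_of_ne t.2.1 fun h => ht (Subtype.ext h.symm)
  have hlt : ∀ t : unitInterval, t ≠ 1 → (t : ℝ) < 1 := fun t ht =>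
    lt_of_le_of_ne t.2.2 fun h => ht (Subtype.ext h)
  refine ⟨f, hf, fun u v _ =>
    { toFun := fun t => AffineMap.lineMap (f u) (f v) (t : ℝ)
      continuous_toFun := AffineMap.lineMap_continuous.comp continuous_subtype_val
      source' := by simp
      target' := by simp }, ?_, ?_, ?_⟩
  · intro u v h s t hst
    exact Subtype.ext (AffineMap.lineMap_injective ℝ (hf.ne h.ne) hst)
  · intro u v h t h0 h1 w
    exact hvertex h t (hpos t h0) (hlt t h1) w
  · intro u v u' v' h h' hne s t h0 h1
    by_cases t0 : t = 0
    · subst t0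
      have := hvertex h s (hpos s h0) (hlt s h1) u'
      simpa using this
    by_cases t1 : t = 1
    · subst t1
      have := hvertex h s (hpos s h0) (hlt s h1) v'
      simpa using this
    exact hedge h h' hne s t (hpos s h0) (hlt s h1) (hpos t t0) (hlt t t1)

/-- If two chords of the parabola `y = x ^ 2` meet above a common interior abscissa and their
endpoints do not interlace, then the chords coincide. -/
theorem eq_of_parabola_chords_meet {a b c d x : ℝ} (hax : a < x) (hxb : x < b) (hcx : c < x)
    (hxd : x < d) (h : (a + b) * x - a * b = (c + d) * x - c * d)
    (h₁ : ¬ (a < c ∧ c < b ∧ b < d)) (h₂ : ¬ (c < a ∧ a < d ∧ d < b)) : a = c ∧ b = d := by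
  have hprod : (x - a) * (b - x) = (x - c) * (d - x) := by linarith
  have hcb := hcx.trans hxb
  have had := hax.trans hxd
  rcases lt_trichotomy a c with hac | rfl | hac
  · have : d ≤ b := by
      by_contra! hbd
      exact h₁ ⟨hac, hcb, hbd⟩
    nlinarith [mul_pos (sub_pos.2 hac) (sub_pos.2 hxb),
      mul_nonneg (sub_pos.2 hcx).le (sub_nonneg.2 this)]
  · refine ⟨rfl, ?_⟩
    have := mul_left_cancel₀ (sub_pos.2 hax).ne' hprod
    linarith
  · have : b ≤ d := by
      by_contra! hbd
      exact h₂ ⟨hac, had, hbd⟩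
    nlinarith [mul_pos (sub_pos.2 hac) (sub_pos.2 hxd),
      mul_nonneg (sub_pos.2 hax).le (sub_nonneg.2 this)]

/-- The parabola points of the vertices, together with a far point below for the apex. -/
def coneDrawing {V : Type*} (x : V → ℝ) (M : ℝ) : Option V → ℝ × ℝ
  | none => (0, -M)
  | some v => (x v, x v ^ 2)

theorem SimpleGraph.mem_cone_segment {V : Type*} {G : SimpleGraph V} {x : V → ℝ}
    (hx : Function.Injective x) (M : ℝ) {u v : Option V} (h : G.cone.Adj u v) {t : ℝ}
    (h0 : 0 < t) (h1 : t < 1) {p : ℝ × ℝ}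
    (hp : AffineMap.lineMap (coneDrawing x M u) (coneDrawing x M v) t = p) :
    (∃ a, s(u, v) = s(none, some a) ∧ ∃ r : ℝ, 0 < r ∧ r < 1 ∧
      p.1 = r * x a ∧ p.2 = r * x a ^ 2 - (1 - r) * M) ∨
    ∃ a b, G.Adj a b ∧ s(u, v) = s(some a, some b) ∧ x a < p.1 ∧ p.1 < x b ∧
      p.2 = (x a + x b) * p.1 - x a * x b := by
  subst hp
  obtain ⟨hne, hadj⟩ := (SimpleGraph.fromRel_adj _ _ _).1 h
  cases u with
  | none =>
    cases v with
    | none => exact absurd rfl hne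
    | some b =>
      refine Or.inl ⟨b, rfl, t, h0, h1, ?_, ?_⟩ <;>
        simp [coneDrawing, AffineMap.lineMap_apply]
      ring
  | some a =>
    cases v with
    | none =>
      refine Or.inl ⟨a, Sym2.eq_swap, 1 - t, by linarith, by linarith, ?_, ?_⟩ <;>
        simp [coneDrawing, AffineMap.lineMap_apply] <;> ring
    | some b =>
      have hab : G.Adj a b := by
        rcases hadj with (⟨u, v, hu, hv, huv⟩ | h) | (⟨u, v, hu, hv, huv⟩ | h)
        · cases hu; cases hv; exact huv
        · cases h
        · cases hu; cases hv; exact huv.symm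
        · cases h
      right
      rcases lt_or_gt_of_ne (hx.ne hab.ne) with hlt | hlt
      · refine ⟨a, b, hab, rfl, ?_, ?_, ?_⟩ <;>
          simp [coneDrawing, AffineMap.lineMap_apply]
        · nlinarith
        · nlinarith
        · ring
      · refine ⟨b, a, hab.symm, Sym2.eq_swap, ?_, ?_, ?_⟩ <;>
          simp [coneDrawing, AffineMap.lineMap_apply]
        · nlinarith
        · nlinarith
        · ring

/-- A finite graph whose vertices can be ordered along a line so that no two edges interlace is
outerplanar. -/
theorem SimpleGraph.isOuterplanar_of_noncrossing {V : Type*} [Finite V] (G : SimpleGraph V)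
    (x : V → ℝ) (hx : Function.Injective x)
    (hcross : ∀ a b c d, G.Adj a b → G.Adj c d → ¬ (x a < x c ∧ x c < x b ∧ x b < x d)) :
    G.IsOuterplanar := by
  obtain ⟨M, hMpos, hM⟩ : ∃ M : ℝ, 0 < M ∧ ∀ v, x v ^ 2 < M := by
    obtain ⟨B, hB⟩ := (Set.finite_range fun v => x v ^ 2).bddAbove
    exact ⟨max B 0 + 1, by positivity, fun v => by
      have := hB ⟨v, rfl⟩
      have := le_max_left B 0
      simp only at *
      linarith⟩
  refine G.cone.isPlanar_of_segments (coneDrawing x M) ?_ ?_ ?_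
  · rintro (_ | u) (_ | v) h
    · rfl
    · have := congrArg Prod.snd h
      simp only [coneDrawing] at this
      nlinarith [sq_nonneg (x v)]
    · have := congrArg Prod.snd h
      simp only [coneDrawing] at this
      nlinarith [sq_nonneg (x u)]
    · exact congrArg some (hx (congrArg Prod.fst h))
  · intro u v h t h0 h1 w hp
    rcases mem_cone_segment hx M h h0 h1 hp with
      ⟨a, -, r, hr0, hr1, hp1, hp2⟩ | ⟨a, b, -, -, hp1, hp2, hp3⟩
    · cases w with
      | none =>
        simp only [coneDrawing] at hp1 hp2
        nlinarith [mul_nonneg hr0.le (sq_nonneg (x a)), mul_pos hr0 hMpos]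
      | some w =>
        simp only [coneDrawing] at hp1 hp2
        rw [hp1] at hp2
        nlinarith [mul_pos (sub_pos.2 hr1) (sub_pos.2 (hM a)),
          mul_nonneg (sub_pos.2 hr1).le (mul_nonneg (sub_pos.2 hr1).le (sq_nonneg (x a)))]
    · cases w with
      | none =>
        simp only [coneDrawing] at hp1 hp2 hp3
        nlinarith [hM a, hM b, sq_nonneg (x a + x b)]
      | some w =>
        simp only [coneDrawing] at hp1 hp2 hp3
        nlinarith [mul_pos (sub_pos.2 hp1) (sub_pos.2 hp2)]
  · intro u v u' v' h h' hne s t hs0 hs1 ht0 ht1 hp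
    rcases mem_cone_segment hx M h hs0 hs1 hp with
      ⟨a, he, r, hr0, hr1, hp1, hp2⟩ | ⟨a, b, hab, he, hp1, hp2, hp3⟩ <;>
    rcases mem_cone_segment hx M h' ht0 ht1 rfl with
      ⟨c, he', q, hq0, hq1, hq1', hq2⟩ | ⟨c, d, hcd, he', hq1, hq2, hq3⟩
    · have hac : x a ≠ x c := fun hac => hne (by rw [he, he', hx hac])
      rw [hp1] at hq1'
      rw [hp2] at hq2
      have hrq : r * q * ((x a - x c) * (M - x a * x c)) = 0 := by
        linear_combination (q * (x c ^ 2 + M)) * hq1' - (q * x c) * hq2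
      have hMac : 0 < M - x a * x c := by
        nlinarith [hM a, hM c, sq_nonneg (x a - x c)]
      have := mul_ne_zero (mul_pos hr0 hq0).ne' (mul_ne_zero (sub_ne_zero.2 hac) hMac.ne')
      exact this hrq
    · rw [hp1] at hq1 hq2 hq3
      rw [hp2] at hq3
      nlinarith [mul_pos (sub_pos.2 hq1) (sub_pos.2 hq2),
        mul_pos (sub_pos.2 hr1) (sub_pos.2 (hM a)),
        mul_nonneg (sub_pos.2 hr1).le (mul_nonneg (sub_pos.2 hr1).le (sq_nonneg (x a)))]
    · rw [hq1'] at hp1 hp2 hp3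
      rw [hq2] at hp3
      nlinarith [mul_pos (sub_pos.2 hp1) (sub_pos.2 hp2),
        mul_pos (sub_pos.2 hq1) (sub_pos.2 (hM c)),
        mul_nonneg (sub_pos.2 hq1).le (mul_nonneg (sub_pos.2 hq1).le (sq_nonneg (x c)))]
    · obtain ⟨hac, hbd⟩ := eq_of_parabola_chords_meet hp1 hp2 hq1 hq2 (hp3.symm.trans hq3)
        (hcross a b c d hab hcd) (hcross c d a b hcd hab)
      exact hne (by rw [he, he', hx hac, hx hbd])

/-- There is a noncrossing graph on at most `n` points of a line, properly coloured by numbers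
below `k`, in which each pair of colours in the relation `S` appears on an edge. -/
def NoncrossingCover (k n : ℕ) (S : ℕ → ℕ → Prop) : Prop :=
  ∃ (V : Finset ℕ) (E : ℕ → ℕ → Prop) (c : ℕ → ℕ), V.card ≤ n ∧
    (∀ i j, E i j → i < j ∧ i ∈ V ∧ j ∈ V ∧ c i < k ∧ c j < k ∧ c i ≠ c j) ∧
    (∀ i j i' j', E i j → E i' j' → ¬ (i < i' ∧ i' < j ∧ j < j')) ∧
    ∀ x y, S x y → ∃ i j, E i j ∧ (c i = x ∧ c j = y ∨ c i = y ∧ c j = x)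

namespace NoncrossingCover

theorem mono {k n n' : ℕ} {S S' : ℕ → ℕ → Prop} (h : NoncrossingCover k n S) (hn : n ≤ n')
    (hS : ∀ x y, S' x y → S x y) : NoncrossingCover k n' S' := by
  obtain ⟨V, E, c, hV, hE, hcross, hcov⟩ := h
  exact ⟨V, E, c, hV.trans hn, hE, hcross, fun x y hxy => hcov x y (hS x y hxy)⟩

theorem empty (k : ℕ) : NoncrossingCover k 0 fun _ _ => False :=
  ⟨∅, fun _ _ => False, id, by simp, by simp, by simp, by simp⟩

theorem union {k n₁ n₂ : ℕ} {S₁ S₂ : ℕ → ℕ → Prop} (h₁ : NoncrossingCover k n₁ S₁)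
    (h₂ : NoncrossingCover k n₂ S₂) :
    NoncrossingCover k (n₁ + n₂) fun x y => S₁ x y ∨ S₂ x y := by
  obtain ⟨V₁, E₁, c₁, hV₁, hE₁, hcross₁, hcov₁⟩ := h₁
  obtain ⟨V₂, E₂, c₂, hV₂, hE₂, hcross₂, hcov₂⟩ := h₂
  obtain ⟨N, hN⟩ : ∃ N, ∀ i ∈ V₁, i < N :=
    ⟨V₁.sup id + 1, fun i hi => Nat.lt_succ_of_le (Finset.le_sup (f := id) hi)⟩
  refine ⟨V₁ ∪ V₂.image (· + N), fun i j => E₁ i j ∨ (N ≤ i ∧ N ≤ j ∧ E₂ (i - N) (j - N)),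
    fun i => if i < N then c₁ i else c₂ (i - N), ?_, ?_, ?_, ?_⟩
  · exact (Finset.card_union_le _ _).trans (add_le_add hV₁ (Finset.card_image_le.trans hV₂))
  · rintro i j (h | ⟨hi, hj, h⟩)
    · obtain ⟨hij, hi, hj, hci, hcj, hc⟩ := hE₁ i j h
      simp [hi, hj, hN i hi, hN j hj, hij, hci, hcj, hc]
    · obtain ⟨hij, hi', hj', hci, hcj, hc⟩ := hE₂ _ _ h
      simp only [Finset.mem_union, Finset.mem_image, hi.not_gt, hj.not_gt, if_false]
      exact ⟨by omega, Or.inr ⟨_, hi', by omega⟩, Or.inr ⟨_, hj', by omega⟩, hci, hcj, hc⟩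
  · rintro i j i' j' (h | ⟨hi, hj, h⟩) (h' | ⟨hi', hj', h'⟩) hlt
    · exact hcross₁ _ _ _ _ h h' hlt
    · have := hN j (hE₁ _ _ h).2.2.1
      omega
    · have := hN i' (hE₁ _ _ h').2.1
      omega
    · exact hcross₂ _ _ _ _ h h' (by omega)
  · rintro x y (h | h)
    · obtain ⟨i, j, hij, hc⟩ := hcov₁ x y h
      refine ⟨i, j, Or.inl hij, ?_⟩
      simpa [hN i (hE₁ _ _ hij).2.1, hN j (hE₁ _ _ hij).2.2.1] using hc
    · obtain ⟨i, j, hij, hc⟩ := hcov₂ x y h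
      exact ⟨i + N, j + N, Or.inr (by simpa using hij), by simpa using hc⟩

theorem iUnion {k n : ℕ} {S : ℕ → ℕ → ℕ → Prop} (N : ℕ)
    (h : ∀ i < N, NoncrossingCover k n (S i)) :
    NoncrossingCover k (N * n) fun x y => ∃ i < N, S i x y := by
  induction N with
  | zero => simpa using empty k
  | succ N ih =>
    refine ((ih fun i hi => h i (by omega)).union (h N (by omega))).mono (by rw [Nat.succ_mul])
      ?_
    rintro x y ⟨i, hi, hS⟩
    rcases Nat.lt_succ_iff_lt_or_eq.1 hi with hi | rfl
    · exact Or.inl ⟨i, hi, hS⟩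
    · exact Or.inr hS

/-- Cover given by the edges of a noncrossing pattern whose endpoints have colours below `k`. -/
theorem of_pattern {k n : ℕ} (V : Finset ℕ) (E : ℕ → ℕ → Prop) (c : ℕ → ℕ)
    (hV : (V.filter fun i => c i < k).card ≤ n)
    (hE : ∀ i j, E i j → i < j ∧ i ∈ V ∧ j ∈ V ∧ c i ≠ c j)
    (hcross : ∀ i j i' j', E i j → E i' j' → ¬ (i < i' ∧ i' < j ∧ j < j')) :
    NoncrossingCover k n fun x y => x < k ∧ y < k ∧
      ∃ i j, E i j ∧ (c i = x ∧ c j = y ∨ c i = y ∧ c j = x) := by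
  refine ⟨V.filter fun i => c i < k, fun i j => E i j ∧ c i < k ∧ c j < k, c, hV, ?_,
    fun i j i' j' h h' => hcross i j i' j' h.1 h'.1, ?_⟩
  · rintro i j ⟨h, hi, hj⟩
    obtain ⟨h1, h2, h3, h4⟩ := hE i j h
    simp [*]
  · rintro x y ⟨hx, hy, i, j, hij, hc⟩
    exact ⟨i, j, ⟨hij, by omega, by omega⟩, hc⟩

theorem exists_outerplanar {k n : ℕ} (hk : 0 < k) (hn : 0 < n)
    (h : NoncrossingCover k n fun x y => x < y ∧ y < k) :
    ∃ H : SimpleGraph (Fin n), H.IsOuterplanar ∧ k ≤ H.achromatic := by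
  obtain ⟨V, E, c, hV, hE, hcross, hcov⟩ := h
  obtain ⟨W, hVW, hW⟩ := Infinite.exists_superset_card_eq V n hV
  let pos := W.orderEmbOfFin hW
  have hpos : ∀ i ∈ V, ∃ u, pos u = i := fun i hi => by
    have : i ∈ Set.range pos := by
      rw [Finset.range_orderEmbOfFin]
      exact hVW hi
    exact this
  let H : SimpleGraph (Fin n) :=
    { Adj := fun u v => E (pos u) (pos v) ∨ E (pos v) (pos u)
      symm := ⟨fun u v h => h.symm⟩
      loopless := ⟨fun u h => by
        rcases h with h | h <;> exact lt_irrefl _ (hE _ _ h).1⟩ }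
  refine ⟨H, H.isOuterplanar_of_noncrossing (fun u => (pos u : ℝ))
    (Nat.cast_injective.comp pos.injective) ?_, ?_⟩
  · intro a b c d hab hcd hlt
    simp only [Nat.cast_lt] at hlt
    rcases hab with h | h
    · rcases hcd with h' | h'
      · exact hcross _ _ _ _ h h' hlt
      · have := (hE _ _ h').1
        omega
    · have := (hE _ _ h).1
      omega
  · let col : Fin n → Fin k := fun u =>
      if hu : c (pos u) < k then ⟨c (pos u), hu⟩ else ⟨0, hk⟩
    have hcol : ∀ u, c (pos u) < k → (col u : ℕ) = c (pos u) := fun u hu => by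
      simp [col, hu]
    have hpair : ∀ i j : Fin k, i ≠ j → ∃ u v, H.Adj u v ∧ col u = i ∧ col v = j := by
      have key : ∀ i j : Fin k, i < j → ∃ u v, H.Adj u v ∧ col u = i ∧ col v = j := by
        intro i j hij
        obtain ⟨p, q, hpq, hc⟩ := hcov i j ⟨hij, j.2⟩
        obtain ⟨-, hp, hq, hcp, hcq, -⟩ := hE p q hpq
        obtain ⟨u, rfl⟩ := hpos p hp
        obtain ⟨v, rfl⟩ := hpos q hq
        rcases hc with ⟨h₁, h₂⟩ | ⟨h₁, h₂⟩
        · exact ⟨u, v, Or.inl hpq, Fin.ext (by rw [hcol u hcp, h₁]),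
            Fin.ext (by rw [hcol v hcq, h₂])⟩
        · exact ⟨v, u, Or.inr hpq, Fin.ext (by rw [hcol v hcq, h₂]),
            Fin.ext (by rw [hcol u hcp, h₁])⟩
      intro i j hij
      rcases lt_or_gt_of_ne hij with h | h
      · exact key i j h
      · obtain ⟨u, v, huv, hu, hv⟩ := key j i h
        exact ⟨v, u, huv.symm, hv, hu⟩
    have hbdd : BddAbove {k | ∃ c : Fin n → Fin k,
        H.IsProperColoring c ∧ H.IsCompleteColoring c} := by
      refine ⟨n, ?_⟩
      rintro l ⟨c, -, hsurj, -⟩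
      simpa using Fintype.card_le_of_surjective c hsurj
    refine le_csSup hbdd ⟨col, ?_, ?_, hpair⟩
    · have key : ∀ u v, E (pos u) (pos v) → col u ≠ col v := by
        intro u v h huv
        obtain ⟨-, -, -, hcu, hcv, hne⟩ := hE _ _ h
        exact hne (by rw [← hcol u hcu, ← hcol v hcv, huv])
      rintro u v (h | h)
      · exact key u v h
      · exact (key v u h).symm
    · intro i
      by_cases hij : ∃ j, i ≠ j
      · obtain ⟨j, hij⟩ := hij
        obtain ⟨u, -, -, hu, -⟩ := hpair i j hij
        exact ⟨u, hu⟩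
      · push Not at hij
        exact ⟨⟨0, hn⟩, (hij _).symm ▸ rfl⟩

end NoncrossingCover

/-- The sequence `0, m - 1, 1, m - 2, …`. -/
def zigzag (m s : ℕ) : ℕ := if s % 2 = 0 then s / 2 else m - (s + 1) / 2

/-- Reduction modulo `2 * m` of a number below `4 * m`. -/
def wrap (m x : ℕ) : ℕ := if x < 2 * m then x else x - 2 * m

/-- The colours along the outer cycle of a double fan: a rotated zigzag on `[0, 2m)` followed by
its copy on `[2m, 4m)`. -/
def doubleFanColor (m i p : ℕ) : ℕ :=
  if p < m then wrap m (i + zigzag m p) else 2 * m + wrap m (i + zigzag m (p - m))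

theorem exists_zigzag_eq {m d : ℕ} (hd : d < m) : ∃ s < m, zigzag m s = d := by
  by_cases h : 2 * d < m
  · exact ⟨2 * d, h, by simp only [zigzag]; split_ifs <;> omega⟩
  · exact ⟨2 * (m - d) - 1, by omega, by simp only [zigzag]; split_ifs <;> omega⟩

theorem exists_wrap_add_eq {m x l : ℕ} (hx : x < 2 * m) (hl : l < m) :
    ∃ i < 2 * m, wrap m (i + l) = x := by
  by_cases h : l ≤ x
  · exact ⟨x - l, by omega, by simp only [wrap]; split_ifs <;> omega⟩
  · exact ⟨x + 2 * m - l, by omega, by simp only [wrap]; split_ifs <;> omega⟩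

theorem exists_wrap_zigzag_step {m x y : ℕ} (hxy : x < y) (hy : y < 2 * m) (hm : y ≠ x + m) :
    ∃ i < 2 * m, ∃ s, s + 1 < m ∧
      (wrap m (i + zigzag m s) = x ∧ wrap m (i + zigzag m (s + 1)) = y ∨
        wrap m (i + zigzag m s) = y ∧ wrap m (i + zigzag m (s + 1)) = x) := by
  obtain ⟨a, b, d, ha, hd0, hd, hab, hb⟩ : ∃ a b d, a < 2 * m ∧ 0 < d ∧ d < m ∧
      (a = x ∧ b = y ∨ a = y ∧ b = x) ∧ (b = a + d ∨ b + 2 * m = a + d) := by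
    by_cases h : y < x + m
    · exact ⟨x, y, y - x, by omega, by omega, by omega, by omega, by omega⟩
    · exact ⟨y, x, x + 2 * m - y, by omega, by omega, by omega, by omega, by omega⟩
  have hb' : b < 2 * m := by omega
  obtain ⟨s, l, hs, hl, hz⟩ : ∃ s l, s + 1 < m ∧ l + d < m ∧
      (zigzag m s = l ∧ zigzag m (s + 1) = l + d ∨
        zigzag m s = l + d ∧ zigzag m (s + 1) = l) := by
    refine ⟨m - 1 - d, (m - d) / 2, by omega, by omega, ?_⟩
    simp only [zigzag]
    split_ifs <;> omega
  obtain ⟨i, hi, hia⟩ := exists_wrap_add_eq (l := l) ha (by omega)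
  have hib : wrap m (i + (l + d)) = b := by
    simp only [wrap] at hia ⊢
    split_ifs at hia ⊢ <;> omega
  refine ⟨i, hi, s, hs, ?_⟩
  rcases hz with ⟨h₁, h₂⟩ | ⟨h₁, h₂⟩ <;> rw [h₁, h₂] <;> omega

/-- The edges of a double fan on `2 * m` points, with centres `0` and `m`. -/
def doubleFanAdj (m p q : ℕ) : Prop :=
  p < q ∧ q < 2 * m ∧ (q = p + 1 ∨ p = 0 ∧ m ≤ q ∨ q = m)

theorem noncrossingCover_doubleFan {m k i : ℕ} (hi : i < 2 * m) :
    NoncrossingCover k (2 * m) fun x y => x < k ∧ y < k ∧ ∃ p q, doubleFanAdj m p q ∧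
      (doubleFanColor m i p = x ∧ doubleFanColor m i q = y ∨
        doubleFanColor m i p = y ∧ doubleFanColor m i q = x) := by
  refine NoncrossingCover.of_pattern (Finset.range (2 * m)) _ _
    ((Finset.card_filter_le _ _).trans (by simp)) ?_ ?_
  · rintro p q ⟨hpq, hq, h⟩
    refine ⟨hpq, by simp; omega, by simpa using hq, ?_⟩
    simp only [doubleFanColor, wrap, zigzag]
    split_ifs <;> omega
  · rintro p q p' q' ⟨h₁, h₂, h₃⟩ ⟨h₄, h₅, h₆⟩ h
    omega

/-- The colours of the gadget: the positions `0, 2, 4, 6, 8` carry a closed walk through the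
colours congruent to `a` modulo `m`, the others carry the colours from `4 * m` on. -/
def gadgetColor (m a p : ℕ) : ℕ :=
  match p with
  | 0 => a
  | 1 => 4 * m
  | 2 => a + m
  | 3 => 4 * m + 1
  | 4 => a + 2 * m
  | 5 => 4 * m
  | 6 => a + 3 * m
  | 7 => 4 * m + 1
  | 8 => a
  | _ => 4 * m + 2

/-- The edges of the gadget: a fan with centre `9` over the path `0, 2, 4, 6, 8`, and a triangle
erected on each edge of this path. -/
def gadgetAdj (p q : ℕ) : Prop :=
  p < q ∧ q < 10 ∧ (q = p + 1 ∨ p % 2 = 0 ∧ (q = p + 2 ∨ q = 9))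

/-- The number of vertices of the gadget when `r` colours from `4 * m` on are available. -/
def gadgetSize (r : ℕ) : ℕ := min (5 + 2 * r) 10

theorem noncrossingCover_gadget {m a r : ℕ} (ha : a < m) (hr : r < 4) :
    NoncrossingCover (4 * m + r) (gadgetSize r) fun x y => x < 4 * m + r ∧ y < 4 * m + r ∧
      ∃ p q, gadgetAdj p q ∧ (gadgetColor m a p = x ∧ gadgetColor m a q = y ∨
        gadgetColor m a p = y ∧ gadgetColor m a q = x) := by
  refine NoncrossingCover.of_pattern (Finset.range 10) _ _ ?_ ?_ ?_
  · have hsub : (Finset.range 10).filter (fun p => gadgetColor m a p < 4 * m + r) ⊆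
        (Finset.range 10).filter fun p =>
          p % 2 = 0 ∨ p % 4 = 1 ∧ p < 9 ∧ 1 ≤ r ∨ p % 4 = 3 ∧ 2 ≤ r ∨ p = 9 ∧ 3 ≤ r := by
      intro p hp
      simp only [Finset.mem_filter, Finset.mem_range] at hp ⊢
      obtain ⟨hp, hc⟩ := hp
      refine ⟨hp, ?_⟩
      interval_cases p <;> simp [gadgetColor] at hc ⊢ <;> omega
    refine (Finset.card_le_card hsub).trans ?_
    interval_cases r <;> decide
  · rintro p q ⟨hpq, hq, h⟩
    refine ⟨hpq, by simp; omega, by simpa using hq, ?_⟩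
    interval_cases q <;> interval_cases p <;> simp [gadgetColor] at h ⊢ <;> omega
  · rintro p q p' q' ⟨h₁, h₂, h₃⟩ ⟨h₄, h₅, h₆⟩ h
    omega

theorem noncrossingCover_triangle {m r : ℕ} (hr : r < 4) :
    NoncrossingCover (4 * m + r) r fun x y => 4 * m ≤ x ∧ x < y ∧ y < 4 * m + r := by
  refine (NoncrossingCover.of_pattern (k := 4 * m + r) (Finset.range r)
    (fun p q => p < q ∧ q < r) (fun p => 4 * m + p)
    ((Finset.card_filter_le _ _).trans (by simp)) ?_ ?_).mono le_rfl ?_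
  · rintro p q ⟨hpq, hq⟩
    simp
    omega
  · rintro p q p' q' ⟨h₁, h₂⟩ ⟨h₃, h₄⟩ h
    omega
  · rintro x y ⟨hx, hxy, hy⟩
    exact ⟨by omega, hy, x - 4 * m, y - 4 * m, by omega, by omega⟩

theorem exists_gadget_edge {m r x y : ℕ} (hr : r < 4) (hx : x < 4 * m) (hxy : x < y)
    (hy : y < 4 * m + r)
    (h : 4 * m ≤ y ∨ y = x + m ∧ (y < 2 * m ∨ 2 * m ≤ x) ∨
      x < 2 * m ∧ 2 * m ≤ y ∧ (y = x + m ∨ y = x + 3 * m)) :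
    ∃ a < m, ∃ p q, gadgetAdj p q ∧ (gadgetColor m a p = x ∧ gadgetColor m a q = y ∨
      gadgetColor m a p = y ∧ gadgetColor m a q = x) := by
  have hx4 : x < m ∨ m ≤ x ∧ x < 2 * m ∨ 2 * m ≤ x ∧ x < 3 * m ∨ 3 * m ≤ x := by omega
  by_cases hy4 : 4 * m ≤ y
  · obtain rfl | rfl | rfl : y = 4 * m ∨ y = 4 * m + 1 ∨ y = 4 * m + 2 := by omega
    · rcases hx4 with h | h | h | h
      · exact ⟨x, h, 0, 1, by simp [gadgetAdj], by simp [gadgetColor]⟩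
      · exact ⟨x - m, by omega, 1, 2, by simp [gadgetAdj], by simp [gadgetColor]; omega⟩
      · exact ⟨x - 2 * m, by omega, 4, 5, by simp [gadgetAdj], by simp [gadgetColor]; omega⟩
      · exact ⟨x - 3 * m, by omega, 5, 6, by simp [gadgetAdj], by simp [gadgetColor]; omega⟩
    · rcases hx4 with h | h | h | h
      · exact ⟨x, h, 7, 8, by simp [gadgetAdj], by simp [gadgetColor]⟩
      · exact ⟨x - m, by omega, 2, 3, by simp [gadgetAdj], by simp [gadgetColor]; omega⟩
      · exact ⟨x - 2 * m, by omega, 3, 4, by simp [gadgetAdj], by simp [gadgetColor]; omega⟩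
      · exact ⟨x - 3 * m, by omega, 6, 7, by simp [gadgetAdj], by simp [gadgetColor]; omega⟩
    · rcases hx4 with h | h | h | h
      · exact ⟨x, h, 0, 9, by simp [gadgetAdj], by simp [gadgetColor]⟩
      · exact ⟨x - m, by omega, 2, 9, by simp [gadgetAdj], by simp [gadgetColor]; omega⟩
      · exact ⟨x - 2 * m, by omega, 4, 9, by simp [gadgetAdj], by simp [gadgetColor]; omega⟩
      · exact ⟨x - 3 * m, by omega, 6, 9, by simp [gadgetAdj], by simp [gadgetColor]; omega⟩
  · obtain h | h | h | h : x < m ∧ y = x + m ∨ m ≤ x ∧ x < 2 * m ∧ y = x + m ∨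
        2 * m ≤ x ∧ x < 3 * m ∧ y = x + m ∨ x < m ∧ y = x + 3 * m := by omega
    · exact ⟨x, h.1, 0, 2, by simp [gadgetAdj], by simp [gadgetColor]; omega⟩
    · exact ⟨x - m, by omega, 2, 4, by simp [gadgetAdj], by simp [gadgetColor]; omega⟩
    · exact ⟨x - 2 * m, by omega, 4, 6, by simp [gadgetAdj], by simp [gadgetColor]; omega⟩
    · exact ⟨x, h.1, 6, 8, by simp [gadgetAdj], by simp [gadgetColor]; omega⟩

theorem exists_doubleFan_edge {m x y : ℕ} (hxy : x < y) (hy : y < 4 * m)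
    (h : y < 2 * m ∧ y ≠ x + m ∨ 2 * m ≤ x ∧ y ≠ x + m ∨
      x < 2 * m ∧ 2 * m ≤ y ∧ y ≠ x + m ∧ y ≠ x + 3 * m) :
    ∃ i < 2 * m, ∃ p q, doubleFanAdj m p q ∧
      (doubleFanColor m i p = x ∧ doubleFanColor m i q = y ∨
        doubleFanColor m i p = y ∧ doubleFanColor m i q = x) := by
  have hleft : ∀ i p, p < m → doubleFanColor m i p = wrap m (i + zigzag m p) :=
    fun i p hp => by simp [doubleFanColor, hp]
  have hright : ∀ i p, doubleFanColor m i (m + p) = 2 * m + wrap m (i + zigzag m p) :=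
    fun i p => by simp [doubleFanColor]
  have hzero : ∀ i < 2 * m, wrap m (i + zigzag m 0) = i := fun i hi => by
    simp [zigzag, wrap, hi]
  rcases h with ⟨hy2, hne⟩ | ⟨hx2, hne⟩ | ⟨hx2, hy2, hne, hne'⟩
  · obtain ⟨i, hi, s, hs, hc⟩ := exists_wrap_zigzag_step hxy hy2 hne
    refine ⟨i, hi, s, s + 1, ⟨by omega, by omega, by omega⟩, ?_⟩
    rwa [hleft i s (by omega), hleft i (s + 1) hs]
  · obtain ⟨i, hi, s, hs, hc⟩ :=
      exists_wrap_zigzag_step (m := m) (x := x - 2 * m) (y := y - 2 * m)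
        (by omega) (by omega) (by omega)
    refine ⟨i, hi, m + s, m + (s + 1), ⟨by omega, by omega, by omega⟩, ?_⟩
    rw [hright, hright]
    omega
  · obtain ⟨z, rfl⟩ := Nat.exists_eq_add_of_le hy2
    obtain ⟨d, hd, hxz⟩ : ∃ d < m, (wrap m (x + d) = z ∨ wrap m (z + d) = x) := by
      simp only [wrap]
      by_cases h₁ : x ≤ z
      · by_cases h₂ : z < x + m
        · exact ⟨z - x, by omega, Or.inl (by split_ifs <;> omega)⟩
        · exact ⟨x + 2 * m - z, by omega, Or.inr (by split_ifs <;> omega)⟩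
      · by_cases h₂ : x < z + m
        · exact ⟨x - z, by omega, Or.inr (by split_ifs <;> omega)⟩
        · exact ⟨z + 2 * m - x, by omega, Or.inl (by split_ifs <;> omega)⟩
    obtain ⟨s, hs, rfl⟩ := exists_zigzag_eq hd
    rcases hxz with hc | hc
    · refine ⟨x, hx2, 0, m + s, ⟨by omega, by omega, by omega⟩, Or.inl ?_⟩
      rw [hright, hleft x 0 (by omega), hzero x hx2, hc]
      exact ⟨rfl, rfl⟩
    · refine ⟨z, by omega, s, m + 0, ⟨by omega, by omega, by omega⟩, Or.inl ?_⟩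
      rw [hright, hleft z s hs, hzero z (by omega), hc]
      exact ⟨rfl, rfl⟩

theorem noncrossingCover_complete {m r : ℕ} (hr : r < 4) :
    NoncrossingCover (4 * m + r) (2 * m * (2 * m) + m * gadgetSize r + r)
      fun x y => x < y ∧ y < 4 * m + r := by
  refine (((NoncrossingCover.iUnion (2 * m) fun i hi => noncrossingCover_doubleFan hi).union
    (NoncrossingCover.iUnion m fun a ha => noncrossingCover_gadget ha hr)).union
    (noncrossingCover_triangle hr)).mono le_rfl ?_
  rintro x y ⟨hxy, hy⟩
  by_cases hx : 4 * m ≤ x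
  · exact Or.inr ⟨hx, hxy, hy⟩
  by_cases h : 4 * m ≤ y ∨ y = x + m ∧ (y < 2 * m ∨ 2 * m ≤ x) ∨
      x < 2 * m ∧ 2 * m ≤ y ∧ (y = x + m ∨ y = x + 3 * m)
  · obtain ⟨a, ha, hedge⟩ := exists_gadget_edge hr (by omega) hxy hy h
    exact Or.inl (Or.inr ⟨a, ha, by omega, hy, hedge⟩)
  · obtain ⟨i, hi, hedge⟩ := exists_doubleFan_edge (m := m) hxy (by omega) (by omega)
    exact Or.inl (Or.inl ⟨i, hi, by omega, hy, hedge⟩)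

theorem noncrossingCover_of_sq_le {k n : ℕ} (h : k ^ 2 + 5 * k + 12 ≤ 4 * n) :
    NoncrossingCover k n fun x y => x < y ∧ y < k := by
  obtain ⟨m, r, hr, rfl⟩ : ∃ m r, r < 4 ∧ k = 4 * m + r :=
    ⟨k / 4, k % 4, by omega, by omega⟩
  refine (noncrossingCover_complete hr).mono ?_ fun x y hxy => hxy
  interval_cases r <;> simp only [gadgetSize] <;> norm_num <;> nlinarith

/-- For every `n ≥ 5` there exists an outerplanar graph `H` of order `n` with
`ψ(H) ≥ ⌊√(4n − 23/4) − 5/2⌋`. -/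
theorem exists_outerplanar_achromatic_ge (n : ℕ) (hn : 5 ≤ n) :
    ∃ H : SimpleGraph (Fin n), H.IsOuterplanar ∧
      ⌊Real.sqrt (4 * n - 23 / 4) - 5 / 2⌋ ≤ (H.achromatic : ℤ) := by
  set k := ⌊Real.sqrt (4 * n - 23 / 4) - 5 / 2⌋ with hk
  have hn' : (5 : ℝ) ≤ n := by exact_mod_cast hn
  have hk1 : 1 ≤ k := by
    rw [hk, Int.le_floor]
    have : (7 / 2 : ℝ) ≤ Real.sqrt (4 * n - 23 / 4) := Real.le_sqrt_of_sq_le (by linarith)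
    push_cast
    linarith
  have hle : (k : ℝ) ≤ Real.sqrt (4 * n - 23 / 4) - 5 / 2 := Int.floor_le _
  clear_value k
  lift k to ℕ using by omega
  have hsq : ((k : ℝ) + 5 / 2) ^ 2 ≤ 4 * n - 23 / 4 := by
    rw [← Real.le_sqrt (by positivity) (by linarith)]
    push_cast at hle
    linarith
  have hkn : k ^ 2 + 5 * k + 12 ≤ 4 * n := by
    have : (k : ℝ) ^ 2 + 5 * k + 12 ≤ 4 * n := by linarith
    exact_mod_cast this
  obtain ⟨H, hH, hkH⟩ :=
    (noncrossingCover_of_sq_le hkn).exists_outerplanar (by omega) (by omega)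
  exact ⟨H, hH, by exact_mod_cast hkH⟩
end
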